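/- arXiv:0907.4840 — 3 statements merged into one kernel-verified Lean document; each statement's English description precedes it below -/
import Mathlib

section
/- Let K be an algebraically closed field of characteristic p > 2 and m, n ≥ 1. If a supersymmetric polynomial f ∈ A_s(m|n) is divisible by x_m, then f is divisible by a nonconstant element of A_ns(m|n). -/
open MvPolynomial

noncomputable section

/-- The substitution `x_m = y_n = T`, landing in polynomials in `T` over the original ring
(the image only involves the remaining variables). -/
def psiSub (K : Type*) [CommSemiring K] (m n : ℕ) :
    MvPolynomial (Fin m ⊕ Fin n) K →ₐ[K] Polynomial (MvPolynomial (Fin m ⊕ Fin n) K) :=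
  MvPolynomial.aeval (Sum.elim
    (fun i : Fin m => if (i : ℕ) = m - 1 then Polynomial.X
      else Polynomial.C (MvPolynomial.X (Sum.inl i)))
    (fun j : Fin n => if (j : ℕ) = n - 1 then Polynomial.X
      else Polynomial.C (MvPolynomial.X (Sum.inr j))))

/-- `f` is supersymmetric: symmetric in the `x` and `y` variables separately, and
`(d/dT) f|_{x_m = y_n = T} = 0`. -/
def IsSupersymmetric (K : Type*) [CommSemiring K] (m n : ℕ)
    (f : MvPolynomial (Fin m ⊕ Fin n) K) : Prop :=
  (∀ σ : Equiv.Perm (Fin m), MvPolynomial.rename (Sum.map σ id) f = f) ∧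
  (∀ τ : Equiv.Perm (Fin n), MvPolynomial.rename (Sum.map id τ) f = f) ∧
  Polynomial.derivative (psiSub K m n f) = 0

/-- `c_r(x|y) = Σ_{i=0}^{min(r,m)} (−1)^{r−i} σ_i(x) h_{r−i}(y)`. -/
def cpoly (K : Type*) [CommRing K] (m n r : ℕ) : MvPolynomial (Fin m ⊕ Fin n) K :=
  ∑ i ∈ Finset.range (min r m + 1),
    (-1 : MvPolynomial (Fin m ⊕ Fin n) K) ^ (r - i) *
      (MvPolynomial.rename Sum.inl (MvPolynomial.esymm (Fin m) K i)) *
      (MvPolynomial.rename Sum.inr (MvPolynomial.hsymm (Fin n) K (r - i)))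

/-- σ_i(x_1,…,x_m), viewed in K[x_1,…,x_m,y_1,…,y_n]. -/
def sigmaX (K : Type*) [CommSemiring K] (m n i : ℕ) : MvPolynomial (Fin m ⊕ Fin n) K :=
  MvPolynomial.rename Sum.inl (MvPolynomial.esymm (Fin m) K i)

/-- σ_j(y_1,…,y_n), viewed in K[x_1,…,x_m,y_1,…,y_n]. -/
def sigmaY (K : Type*) [CommSemiring K] (m n j : ℕ) : MvPolynomial (Fin m ⊕ Fin n) K :=
  MvPolynomial.rename Sum.inr (MvPolynomial.esymm (Fin n) K j)

/-- The generators of the algebra `A_ns(m|n)` of nice supersymmetric polynomials: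
`c_r` (r ≥ 0), `σ_i(x)^p` (1 ≤ i ≤ m), `σ_j(y)^p` (1 ≤ j ≤ n) and
`u_k = σ_m(x)^k σ_n(y)^{p-k}` (0 < k < p). -/
def nsGens (K : Type*) [CommRing K] (p m n : ℕ) : Set (MvPolynomial (Fin m ⊕ Fin n) K) :=
  {f | ∃ r : ℕ, f = cpoly K m n r} ∪
  {f | ∃ i : ℕ, 1 ≤ i ∧ i ≤ m ∧ f = (sigmaX K m n i) ^ p} ∪
  {f | ∃ j : ℕ, 1 ≤ j ∧ j ≤ n ∧ f = (sigmaY K m n j) ^ p} ∪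
  {f | ∃ k : ℕ, 0 < k ∧ k < p ∧ f = (sigmaX K m n m) ^ k * (sigmaY K m n n) ^ (p - k)}

/-- The evaluation morphism `p_e` sending `x_i ↦ x_i` (i ≤ m), `y_j ↦ y_j` (j ≤ n) and the
remaining variables to `0`. -/
def pe (K : Type*) [CommSemiring K] (M N m n : ℕ) :
    MvPolynomial (Fin M ⊕ Fin N) K →ₐ[K] MvPolynomial (Fin m ⊕ Fin n) K :=
  MvPolynomial.aeval (Sum.elim
    (fun i : Fin M => if h : (i : ℕ) < m then MvPolynomial.X (Sum.inl ⟨(i : ℕ), h⟩) else 0)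
    (fun j : Fin N => if h : (j : ℕ) < n then MvPolynomial.X (Sum.inr ⟨(j : ℕ), h⟩) else 0))

end

noncomputable section

namespace Supersymmetric

section GeneratingSeries

variable {A B ι κ : Type*} [CommRing A] [CommRing B] [Fintype ι] [Fintype κ]

/-- The geometric series `1 / (1 + z t)`. -/
def geomSeries (z : A) : PowerSeries A := PowerSeries.mk fun r => (-z) ^ r

/-- The generating series `∏ (1 + x_i t)` of the elementary symmetric polynomials. -/
def elemSeries (x : ι → A) : PowerSeries A := ∏ i, (1 + PowerSeries.C (x i) * PowerSeries.X)

/-- The series `∏ 1 / (1 + y_j t)`. -/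
def homSeries (y : κ → A) : PowerSeries A := ∏ j, geomSeries (y j)

/-- The generating series `∏ (1 + x_i t) / ∏ (1 + y_j t)` of the polynomials `c_r(x|y)`. -/
def superSeries (x : ι → A) (y : κ → A) : PowerSeries A := elemSeries x * homSeries y

lemma one_add_mul_geomSeries (z : A) :
    (1 + PowerSeries.C z * PowerSeries.X) * geomSeries z = 1 := by
  ext r
  rcases r with _ | r
  · simp [geomSeries]
  · simp only [add_mul, one_mul, map_add, mul_assoc, PowerSeries.coeff_C_mul,
      PowerSeries.coeff_succ_X_mul, geomSeries, PowerSeries.coeff_mk, PowerSeries.coeff_one]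
    simp [pow_succ]
    ring

lemma elemSeries_mul_homSeries (y : κ → A) : elemSeries y * homSeries y = 1 := by
  simp [elemSeries, homSeries, ← Finset.prod_mul_distrib, one_add_mul_geomSeries]

lemma superSeries_mul_elemSeries (x : ι → A) (y : κ → A) :
    superSeries x y * elemSeries y = elemSeries x := by
  rw [superSeries, mul_assoc, mul_comm (homSeries y), elemSeries_mul_homSeries, mul_one]

lemma map_geomSeries (f : A →+* B) (z : A) :
    PowerSeries.map f (geomSeries z) = geomSeries (f z) := by
  ext; simp [geomSeries]

lemma map_elemSeries (f : A →+* B) (x : ι → A) :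
    PowerSeries.map f (elemSeries x) = elemSeries (f ∘ x) := by
  simp [elemSeries, map_prod]

lemma map_homSeries (f : A →+* B) (x : ι → A) :
    PowerSeries.map f (homSeries x) = homSeries (f ∘ x) := by
  simp [homSeries, map_prod, map_geomSeries]

lemma map_superSeries (f : A →+* B) (x : ι → A) (y : κ → A) :
    PowerSeries.map f (superSeries x y) = superSeries (f ∘ x) (f ∘ y) := by
  simp [superSeries, map_elemSeries, map_homSeries]

lemma elemSeries_comp_equiv {ι' : Type*} [Fintype ι'] (x : ι → A) (e : ι' ≃ ι) :
    elemSeries (x ∘ e) = elemSeries x :=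
  Fintype.prod_equiv e _ _ fun _ => rfl

lemma homSeries_comp_equiv {ι' : Type*} [Fintype ι'] (x : ι → A) (e : ι' ≃ ι) :
    homSeries (x ∘ e) = homSeries x :=
  Fintype.prod_equiv e _ _ fun _ => rfl

lemma superSeries_comp_equiv {ι' κ' : Type*} [Fintype ι'] [Fintype κ'] (x : ι → A) (y : κ → A)
    (e : ι' ≃ ι) (e' : κ' ≃ κ) : superSeries (x ∘ e) (y ∘ e') = superSeries x y := by
  rw [superSeries, elemSeries_comp_equiv, homSeries_comp_equiv, superSeries]

lemma elemSeries_sumElim (x : ι → A) (y : κ → A) :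
    elemSeries (Sum.elim x y) = elemSeries x * elemSeries y := by
  simp [elemSeries]

lemma homSeries_sumElim (x : ι → A) (y : κ → A) :
    homSeries (Sum.elim x y) = homSeries x * homSeries y := by
  simp [homSeries]

/-- Common variables cancel in the generating series of the `c_r`. -/
lemma superSeries_sumElim {τ : Type*} [Fintype τ] (x : ι → A) (y : κ → A) (t : τ → A) :
    superSeries (Sum.elim x t) (Sum.elim y t) = superSeries x y := by
  rw [superSeries, elemSeries_sumElim, homSeries_sumElim, mul_mul_mul_comm,
    elemSeries_mul_homSeries, mul_one, superSeries]

lemma coeff_elemSeries (x : ι → A) (r : ℕ) :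
    PowerSeries.coeff r (elemSeries x) =
      ∑ t ∈ Finset.powersetCard r Finset.univ, ∏ i ∈ t, x i := by
  classical
  rw [elemSeries, Finset.prod_one_add, map_sum,
    Finset.powersetCard_eq_filter, Finset.sum_filter]
  refine Finset.sum_congr rfl fun t _ => ?_
  rw [Finset.prod_mul_distrib, ← map_prod, Finset.prod_const, PowerSeries.coeff_C_mul,
    PowerSeries.coeff_X_pow]
  simp [eq_comm]

lemma coeff_elemSeries_eq_aeval_esymm [Algebra B A] (x : ι → A) (r : ℕ) :
    PowerSeries.coeff r (elemSeries x) = aeval x (esymm ι B r) := by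
  simp [coeff_elemSeries, esymm, map_sum, map_prod]

lemma coeff_homSeries_eq_aeval_hsymm [DecidableEq ι] [Algebra B A] (y : ι → A) (r : ℕ) :
    PowerSeries.coeff r (homSeries y) = (-1) ^ r * aeval y (hsymm ι B r) := by
  rw [homSeries, PowerSeries.coeff_prod, hsymm, map_sum, Finset.mul_sum]
  symm
  refine Finset.sum_bij (fun s _ => Multiset.toFinsupp s.1) ?_ ?_ ?_ ?_
  · intro s _
    rw [Finset.mem_finsuppAntidiag]
    refine ⟨?_, Finset.subset_univ _⟩
    change ∑ i, Multiset.toFinsupp s.1 i = r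
    simp only [Multiset.toFinsupp_apply]
    exact (Multiset.sum_count_eq_card fun _ _ => Finset.mem_univ _).trans s.2
  · intro s _ t _ h
    exact Subtype.ext (Multiset.toFinsupp.injective h)
  · intro d hd
    rw [Finset.mem_finsuppAntidiag] at hd
    refine ⟨⟨Finsupp.toMultiset d, ?_⟩, Finset.mem_univ _, by simp⟩
    rw [Finsupp.card_toMultiset, Finsupp.sum_fintype _ _ (fun _ => rfl)]
    exact hd.1
  · intro s _
    have hc : ∑ i, s.1.count i = r :=
      (Multiset.sum_count_eq_card fun _ _ => Finset.mem_univ _).trans s.2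
    simp only [geomSeries, PowerSeries.coeff_mk, Multiset.toFinsupp_apply]
    simp_rw [neg_pow (y _)]
    rw [Finset.prod_mul_distrib, Finset.prod_pow_eq_pow_sum, hc, map_multiset_prod,
      Multiset.map_map]
    congr 1
    rw [Finset.prod_multiset_map_count]
    simp only [Function.comp_apply, aeval_X]
    refine Finset.prod_subset (Finset.subset_univ _) fun i _ hi => ?_
    rw [Multiset.mem_toFinset] at hi
    rw [Multiset.count_eq_zero_of_notMem hi, pow_zero]

lemma coeff_elemSeries_mul_geomSeries {ι' : Type*} (s : Finset ι') (x : ι' → A) (z : A) (r : ℕ) :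
    PowerSeries.coeff (s.card + r)
      ((∏ i ∈ s, (1 + PowerSeries.C (x i) * PowerSeries.X)) * geomSeries z) =
      (-z) ^ r * ∏ i ∈ s, (x i - z) := by
  classical
  induction s using Finset.induction_on generalizing r with
  | empty => simp [geomSeries]
  | insert a s ha ih =>
    have h := ih (r + 1)
    rw [← add_assoc] at h
    rw [Finset.prod_insert ha, Finset.prod_insert ha, Finset.card_insert_of_notMem ha,
      mul_assoc, add_mul, one_mul, mul_assoc, map_add, PowerSeries.coeff_C_mul,
      add_right_comm, PowerSeries.coeff_succ_X_mul, ih, h]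
    ring

lemma coeff_elemSeries_of_card_lt (x : ι → A) {r : ℕ} (h : Fintype.card ι < r) :
    PowerSeries.coeff r (elemSeries x) = 0 := by
  rw [coeff_elemSeries, Finset.powersetCard_eq_empty.2 (by simpa using h), Finset.sum_empty]

end GeneratingSeries

section Determinant

variable {A ι : Type*} [CommRing A] [Fintype ι] {b : ℕ}

/-- The matrix of the `c_{m + r_i - j}`, with the convention `c_s = 0` for `s < 0`. -/
def superMatrix (x : ι → A) (y : Fin b → A) (r : Fin b → ℕ) : Matrix (Fin b) (Fin b) A :=
  Matrix.of fun i j =>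
    PowerSeries.coeff (Fintype.card ι + r i) (PowerSeries.X ^ (j : ℕ) * superSeries x y)

/-- The matrix of the elementary symmetric polynomials in all but one of the variables. -/
def omitMatrix (y : Fin b → A) : Matrix (Fin b) (Fin b) A :=
  Matrix.of fun j k =>
    PowerSeries.coeff (j : ℕ) (elemSeries fun l : {l : Fin b // l ≠ k} => y l)

lemma elemSeries_omit (y : Fin b → A) (k : Fin b) :
    elemSeries y = (1 + PowerSeries.C (y k) * PowerSeries.X) *
      elemSeries fun l : {l : Fin b // l ≠ k} => y l :=
  Fintype.prod_eq_mul_prod_subtype_ne _ k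

lemma superMatrix_mul_omitMatrix (x : ι → A) (y : Fin b → A) (r : Fin b → ℕ) :
    superMatrix x y r * omitMatrix y =
      Matrix.of fun i k => (∏ a, (x a - y k)) * (-y k) ^ r i := by
  ext i k
  have hQ : (elemSeries fun l : {l : Fin b // l ≠ k} => y l) =
      ∑ j : Fin b, PowerSeries.C (omitMatrix y j k) * PowerSeries.X ^ (j : ℕ) := by
    ext s
    simp only [map_sum, PowerSeries.coeff_C_mul, PowerSeries.coeff_X_pow]
    by_cases hs : s < b
    · rw [Finset.sum_eq_single ⟨s, hs⟩]
      · simp [omitMatrix]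
      · intro j _ hj
        rw [if_neg (fun h => hj (Fin.ext h.symm)), mul_zero]
      · simp
    · rw [coeff_elemSeries_of_card_lt, Finset.sum_eq_zero]
      · intro j _
        rw [if_neg (by omega), mul_zero]
      · have : 0 < b := k.pos
        rw [Fintype.card_subtype_compl]
        simp; omega
  have hcancel : superSeries x y * (elemSeries fun l : {l : Fin b // l ≠ k} => y l) =
      elemSeries x * geomSeries (y k) := by
    have h := superSeries_mul_elemSeries x y
    rw [elemSeries_omit y k] at h
    linear_combination geomSeries (y k) * h -
      superSeries x y * (elemSeries fun l : {l : Fin b // l ≠ k} => y l) *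
        one_add_mul_geomSeries (y k)
  have key := coeff_elemSeries_mul_geomSeries Finset.univ x (y k) (r i)
  rw [Matrix.mul_apply, Matrix.of_apply, mul_comm, ← key]
  change _ = PowerSeries.coeff _ (elemSeries x * geomSeries (y k))
  rw [← hcancel, hQ, Finset.mul_sum, map_sum]
  refine Finset.sum_congr rfl fun j _ => ?_
  rw [mul_left_comm, PowerSeries.coeff_C_mul, mul_comm, mul_comm (superSeries x y)]
  rfl

lemma det_omitMatrix (y : Fin b → A) :
    (omitMatrix y).det = (Matrix.of fun i k : Fin b => (-y k) ^ (i : ℕ)).det := by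
  have h := congrArg Matrix.det
    (superMatrix_mul_omitMatrix (fun a : Empty => a.elim) y fun i => (i : ℕ))
  rw [Matrix.det_mul, Matrix.det_of_isLowerTriangular] at h
  · rw [Finset.prod_eq_one, one_mul] at h
    · simpa using h
    · intro i _
      simp [superMatrix, PowerSeries.coeff_X_pow_mul', superSeries, elemSeries, homSeries,
        geomSeries, map_prod]
  · intro i j hij
    replace hij : i < j := hij
    simp [superMatrix, PowerSeries.coeff_X_pow_mul', not_le.2 hij]

lemma det_superMatrix_mul (x : ι → A) (y : Fin b → A) (r : Fin b → ℕ) :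
    (superMatrix x y r).det * (Matrix.of fun i k : Fin b => (-y k) ^ (i : ℕ)).det =
      (∏ k, ∏ a, (x a - y k)) * (Matrix.of fun i k : Fin b => (-y k) ^ r i).det := by
  rw [← det_omitMatrix, ← Matrix.det_mul, superMatrix_mul_omitMatrix]
  exact Matrix.det_mul_row _ _

end Determinant

section Symmetric

lemma closure_le_of_mul_mem {B : Type*} [CommRing B] {s : Set B} (T : AddSubgroup B)
    (h1 : 1 ∈ T) (hs : ∀ g ∈ s, ∀ t ∈ T, g * t ∈ T) {g : B} (hg : g ∈ Subring.closure s) :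
    g ∈ T := by
  suffices h : ∀ t ∈ T, g * t ∈ T by simpa using h 1 h1
  induction hg using Subring.closure_induction with
  | mem g hg => exact hs g hg
  | zero => simp
  | one => simp
  | add x y _ _ hx hy => intro t ht; rw [add_mul]; exact T.add_mem (hx t ht) (hy t ht)
  | neg x _ hx => intro t ht; rw [neg_mul]; exact T.neg_mem (hx t ht)
  | mul x y _ _ hx hy => intro t ht; rw [mul_assoc]; exact hx _ (hy t ht)

/-- The fundamental theorem of symmetric polynomials with coefficients in a subring. -/
lemma mem_closure_esymm {B : Type*} [CommRing B] (S : Subring B) {n : ℕ}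
    {G : MvPolynomial (Fin n) B} (hG : G.IsSymmetric) (hc : ∀ e, coeff e G ∈ S) :
    G ∈ Subring.closure (C '' (S : Set B) ∪ Set.range (esymm (Fin n) B)) := by
  have hinj : Function.Injective (map (σ := Fin n) S.subtype) :=
    map_injective _ Subtype.val_injective
  obtain ⟨G, rfl⟩ : ∃ G₀, map S.subtype G₀ = G := by
    have : G ∈ Set.range (map (σ := Fin n) S.subtype) := by
      rw [mem_range_map_iff_coeffs_subset]
      intro a ha
      rw [Finset.mem_coe, mem_coeffs_iff] at ha
      obtain ⟨e, -, rfl⟩ := ha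
      exact ⟨⟨_, hc e⟩, rfl⟩
    exact this
  have hG₀ : G.IsSymmetric := fun τ => hinj (by rw [map_rename]; exact hG τ)
  obtain ⟨H, hH⟩ := esymmAlgHom_surjective (σ := Fin n) (R := S) (n := n) (by simp) ⟨G, hG₀⟩
  replace hH := congrArg Subtype.val hH
  rw [esymmAlgHom_apply] at hH
  simp only at hH
  rw [← hH]
  clear hH hc hG
  induction H using MvPolynomial.induction_on with
  | C a =>
    rw [aeval_C, algebraMap_eq, map_C]
    exact Subring.subset_closure (Or.inl ⟨a, a.2, rfl⟩)
  | add p q hp hq => rw [map_add, map_add]; exact Subring.add_mem _ hp hq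
  | mul_X p i hp =>
    rw [map_mul, map_mul, aeval_X, map_esymm]
    exact Subring.mul_mem _ hp (Subring.subset_closure (Or.inr ⟨_, rfl⟩))

end Symmetric

section LinearFactors

variable {A σ : Type*} [CommRing A]

/-- Substituting `x_i = z`. -/
def substVar [DecidableEq σ] (i : σ) (z : A) : MvPolynomial σ A →ₐ[A] MvPolynomial σ A :=
  aeval (Function.update X i (C z))

lemma X_sub_C_dvd_iff [DecidableEq σ] (i : σ) (z : A) (F : MvPolynomial σ A) :
    X i - C z ∣ F ↔ substVar i z F = 0 := by
  constructor
  · rintro ⟨G, rfl⟩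
    simp [substVar]
  · intro h
    rw [← Ideal.mem_span_singleton, ← Ideal.Quotient.eq_zero_iff_mem]
    have key : (Ideal.Quotient.mkₐ A (Ideal.span {X i - C z})).comp (substVar i z) =
        Ideal.Quotient.mkₐ A (Ideal.span {(X i - C z : MvPolynomial σ A)}) := by
      ext k
      by_cases hk : k = i
      · subst hk
        simp only [AlgHom.comp_apply, substVar, aeval_X, Function.update_self]
        exact (Ideal.Quotient.eq.2 (Ideal.mem_span_singleton_self _)).symm
      · simp [substVar, hk]
    have := DFunLike.congr_fun key F
    rw [AlgHom.comp_apply, h, map_zero] at this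
    exact this.symm

lemma prime_X_sub_C [IsDomain A] (i : σ) (z : A) : Prime (X i - C z : MvPolynomial σ A) := by
  classical
  have h0 : (X i - C z : MvPolynomial σ A) ≠ 0 := by
    intro h
    have := congrArg (coeff (Finsupp.single i 1)) h
    simp [coeff_C, eq_comm (a := (0 : σ →₀ ℕ))] at this
  rw [← Ideal.span_singleton_prime h0]
  have : Ideal.span {X i - C z} = RingHom.ker (substVar i z) := by
    ext F
    rw [Ideal.mem_span_singleton, X_sub_C_dvd_iff, RingHom.mem_ker]
  rw [this]
  exact RingHom.ker_isPrime _

lemma isRelPrime_X_sub_C [IsDomain A] {i j : σ} {z w : A} (h : i ≠ j ∨ z ≠ w) :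
    IsRelPrime (X i - C z : MvPolynomial σ A) (X j - C w) := by
  classical
  rw [(prime_X_sub_C i z).irreducible.isRelPrime_iff_not_dvd, X_sub_C_dvd_iff]
  by_cases hij : j = i
  · subst hij
    simp only [substVar, map_sub, aeval_X, Function.update_self, aeval_C, algebraMap_eq]
    rw [← C_sub, C_eq_zero, sub_eq_zero]
    simpa using h
  · have := (prime_X_sub_C j w).ne_zero
    simpa [substVar, hij] using this

lemma prod_X_sub_C_dvd [IsDomain A] [UniqueFactorizationMonoid A] [Fintype σ] [DecidableEq σ]
    {κ : Type*} [Fintype κ]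
    {z : κ → A} (hz : Function.Injective z) {F : MvPolynomial σ A}
    (hF : ∀ i k, substVar i (z k) F = 0) : ∏ k, ∏ i, (X i - C (z k)) ∣ F := by
  rw [← Finset.prod_product']
  refine Finset.prod_dvd_of_isRelPrime ?_ fun q _ => (X_sub_C_dvd_iff _ _ _).2 (hF _ _)
  rintro ⟨k, i⟩ - ⟨k', i'⟩ - hne
  refine isRelPrime_X_sub_C ?_
  by_contra! h
  exact hne (Prod.ext (hz h.2) h.1)

end LinearFactors

section Derivative

/-- In characteristic `p`, a polynomial all of whose partial derivatives vanish is a polynomial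
in the `p`-th powers of the variables. -/
lemma exists_expand_eq {A σ : Type*} [CommRing A] [IsDomain A] (p : ℕ) [CharP A p]
    {G : MvPolynomial σ A} (hG : ∀ t, pderiv t G = 0) : ∃ G', expand p G' = G := by
  have hdvd : ∀ e ∈ G.support, ∀ t, p ∣ e t := by
    intro e he t
    by_cases h0 : e t = 0
    · simp [h0]
    have h := congrArg (coeff (e - Finsupp.single t 1)) (hG t)
    rw [coeff_pderiv, coeff_zero, tsub_add_cancel_of_le
      (Finsupp.single_le_iff.2 (Nat.pos_of_ne_zero h0))] at h
    rw [← CharP.cast_eq_zero_iff A p]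
    have := (mul_eq_zero.1 h).resolve_left (mem_support_iff.1 he)
    rw [Finsupp.tsub_apply, Finsupp.single_eq_same] at this
    rw [← this]
    exact_mod_cast congrArg (Nat.cast (R := A)) (by omega : e t = e t - 1 + 1)
  refine ⟨∑ e ∈ G.support, monomial (e.mapRange (· / p) (by simp)) (coeff e G), ?_⟩
  conv_rhs => rw [G.as_sum]
  rw [map_sum]
  refine Finset.sum_congr rfl fun e he => ?_
  rw [expand_monomial]
  refine congrArg (fun d => monomial d (coeff e G)) (Finsupp.ext fun t => ?_)
  simp [Nat.mul_div_cancel' (hdvd e he t)]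

end Derivative

section Bisymmetric

variable (K : Type*) [Field K] (a b : ℕ)

/-- The variables `x_i`. -/
abbrev xVar : Fin a → MvPolynomial (Fin a) (MvPolynomial (Fin b) K) := X

/-- The variables `y_j`. -/
abbrev yVar : Fin b → MvPolynomial (Fin a) (MvPolynomial (Fin b) K) := fun j => C (X j)

/-- The product of all `x_i - y_j`. -/
def diffProd : MvPolynomial (Fin a) (MvPolynomial (Fin b) K) :=
  ∏ k : Fin b, ∏ i : Fin a, (X i - C (X k))

/-- Polynomials that are symmetric in the `x_i` and in the `y_j` separately. -/
def bisymmetric : Subring (MvPolynomial (Fin a) (MvPolynomial (Fin b) K)) where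
  carrier := {G | G.IsSymmetric ∧
    ∀ τ : Equiv.Perm (Fin b), map (rename τ : _ →ₐ[K] MvPolynomial (Fin b) K).toRingHom G = G}
  mul_mem' h h' := ⟨h.1.mul h'.1, fun τ => by rw [map_mul, h.2, h'.2]⟩
  one_mem' := ⟨IsSymmetric.one, fun τ => map_one _⟩
  add_mem' h h' := ⟨h.1.add h'.1, fun τ => by rw [map_add, h.2, h'.2]⟩
  zero_mem' := ⟨IsSymmetric.zero, fun τ => map_zero _⟩
  neg_mem' h := ⟨h.1.neg, fun τ => by rw [map_neg, h.2]⟩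

/-- The series whose coefficients are the `c_r(x|y)`. -/
def cSeries : PowerSeries (MvPolynomial (Fin a) (MvPolynomial (Fin b) K)) :=
  superSeries (xVar K a b) (yVar K a b)

/-- The algebra generated by the `c_r(x|y)`. -/
def cAlgebra : Subalgebra K (MvPolynomial (Fin a) (MvPolynomial (Fin b) K)) :=
  Algebra.adjoin K (Set.range fun r => PowerSeries.coeff r (cSeries K a b))

variable {K a b}

lemma diffProd_ne_zero : diffProd K a b ≠ 0 :=
  Finset.prod_ne_zero_iff.2 fun _ _ => Finset.prod_ne_zero_iff.2 fun _ _ =>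
    (prime_X_sub_C _ _).ne_zero

lemma diffProd_mem_bisymmetric : diffProd K a b ∈ bisymmetric K a b := by
  refine ⟨fun σ => ?_, fun τ => ?_⟩
  · simp only [diffProd, map_prod, map_sub, rename_X, rename_C]
    exact Finset.prod_congr rfl fun k _ => Fintype.prod_equiv σ _ _ fun _ => rfl
  · simp only [diffProd, map_prod, map_sub, map_X, map_C]
    refine Fintype.prod_equiv τ _ _ fun k => Finset.prod_congr rfl fun i _ => ?_
    simp

lemma coeff_cSeries_mem (r : ℕ) : PowerSeries.coeff r (cSeries K a b) ∈ cAlgebra K a b :=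
  Algebra.subset_adjoin ⟨r, rfl⟩

lemma det_superMatrix_mem (r : Fin b → ℕ) :
    (superMatrix (xVar K a b) (yVar K a b) r).det ∈ cAlgebra K a b := by
  rw [Matrix.det_apply']
  refine sum_mem fun σ _ => mul_mem (intCast_mem _ _) (prod_mem fun i _ => ?_)
  simp only [superMatrix, Matrix.of_apply, PowerSeries.coeff_X_pow_mul']
  split_ifs
  · exact coeff_cSeries_mem _
  · exact zero_mem _

/-- The expansion of an alternant times a symmetric polynomial into alternants. -/
lemma det_mul_symmetric {h : MvPolynomial (Fin b) K} (hh : h.IsSymmetric) :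
    (Matrix.of fun i k : Fin b => (-X k : MvPolynomial (Fin b) K) ^ (i : ℕ)).det * h =
      ∑ e ∈ h.support, C (coeff e h) * (-1) ^ (∑ i, e i) *
        (Matrix.of fun i k : Fin b => (-X k : MvPolynomial (Fin b) K) ^ ((i : ℕ) + e i)).det := by
  have key (σ : Equiv.Perm (Fin b)) :
      h = ∑ e ∈ h.support, C (coeff e h) * (-1) ^ (∑ i, e i) * ∏ i, (-X i) ^ e (σ i) := by
    conv_lhs => rw [← hh σ.symm, h.as_sum]
    rw [map_sum]
    refine Finset.sum_congr rfl fun e _ => ?_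
    rw [monomial_eq, map_mul, rename_C, Finsupp.prod_fintype _ _ (by simp), map_prod, mul_assoc]
    congr 1
    have : ∏ i, (-X i : MvPolynomial (Fin b) K) ^ e (σ i) =
        (-1) ^ (∑ i, e i) * ∏ i, X i ^ e (σ i) := by
      simp_rw [neg_pow (X _ : MvPolynomial (Fin b) K)]
      rw [Finset.prod_mul_distrib, Finset.prod_pow_eq_pow_sum, Equiv.sum_comp σ e]
    rw [this, ← mul_assoc, ← mul_pow, neg_one_mul, neg_neg, one_pow, one_mul]
    refine (Fintype.prod_equiv σ _ _ fun i => ?_).symm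
    simp
  simp only [Matrix.det_apply', Finset.sum_mul, Finset.mul_sum, Matrix.of_apply]
  rw [Finset.sum_comm]
  refine Finset.sum_congr rfl fun σ _ => ?_
  conv_lhs => rw [key σ]
  rw [Finset.mul_sum]
  refine Finset.sum_congr rfl fun e _ => ?_
  simp only [pow_add, Finset.prod_mul_distrib]
  ring

lemma diffProd_mul_C_mem {h : MvPolynomial (Fin b) K} (hh : h.IsSymmetric) :
    diffProd K a b * C h ∈ cAlgebra K a b := by
  set V := (Matrix.of fun i k : Fin b => (-X k : MvPolynomial (Fin b) K) ^ (i : ℕ)).det with hV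
  have hV0 : V ≠ 0 := by
    rw [hV, ← Matrix.det_transpose]
    refine Matrix.det_vandermonde_ne_zero_iff.2 ?_
    exact fun i j hij => X_injective (neg_injective hij)
  have hdet (r : Fin b → ℕ) :
      C (Matrix.of fun i k : Fin b => (-X k : MvPolynomial (Fin b) K) ^ r i).det =
        (Matrix.of fun i k : Fin b =>
          (-yVar K a b k) ^ r i).det := by
    rw [RingHom.map_det]
    congr 1
    ext i k : 2
    simp
  have key : diffProd K a b * C h = ∑ e ∈ h.support,
      algebraMap K _ (coeff e h) * (-1) ^ (∑ i, e i) *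
        (superMatrix (xVar K a b) (yVar K a b) fun i => (i : ℕ) + e i).det := by
    refine mul_right_cancel₀ (b := C V) (by simpa using hV0) ?_
    rw [mul_assoc, ← C_mul, mul_comm h, hV, det_mul_symmetric hh, map_sum, Finset.mul_sum,
      Finset.sum_mul]
    refine Finset.sum_congr rfl fun e _ => ?_
    rw [mul_assoc (algebraMap K _ _ * _), hdet fun i => (i : ℕ), det_superMatrix_mul, ← hdet,
      C_mul, C_mul]
    simp only [map_pow, map_neg, map_one, diffProd]
    rw [show C (C (coeff e h)) = algebraMap K
      (MvPolynomial (Fin a) (MvPolynomial (Fin b) K)) (coeff e h) from rfl]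
    ring
  rw [key]
  exact sum_mem fun e _ => mul_mem (mul_mem (Subalgebra.algebraMap_mem _ _)
    (pow_mem (neg_mem (one_mem _)) _)) (det_superMatrix_mem _)

lemma isSymmetric_coeff_elemSeries (r : ℕ) :
    (PowerSeries.coeff r (elemSeries (X : Fin b → MvPolynomial (Fin b) K))).IsSymmetric := by
  rw [coeff_elemSeries_eq_aeval_esymm (B := K), aeval_X_left_apply]
  exact esymm_isSymmetric _ _ _

/-- The multiples of `∏ (x_i - y_j)` by bisymmetric polynomials are polynomials in the `c_r`. -/
lemma diffProd_mul_mem {G : MvPolynomial (Fin a) (MvPolynomial (Fin b) K)}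
    (hG : G ∈ bisymmetric K a b) : diffProd K a b * G ∈ cAlgebra K a b := by
  let T : AddSubgroup (MvPolynomial (Fin a) (MvPolynomial (Fin b) K)) :=
    { carrier := {g | ∀ h : MvPolynomial (Fin b) K, h.IsSymmetric →
        diffProd K a b * g * C h ∈ cAlgebra K a b}
      add_mem' := fun hg hg' h hh => by
        rw [mul_add, add_mul]; exact add_mem (hg h hh) (hg' h hh)
      zero_mem' := fun h _ => by simp
      neg_mem' := fun hg h hh => by
        have := neg_mem (hg h hh); convert this using 1; ring }
  have hT : G ∈ T := by
    refine closure_le_of_mul_mem T ?_ ?_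
      (mem_closure_esymm (symmetricSubalgebra (Fin b) K).toSubring hG.1 fun e τ => ?_)
    · intro h hh
      rw [mul_one]
      exact diffProd_mul_C_mem hh
    · rintro _ (⟨h', hh', rfl⟩ | ⟨r, rfl⟩) t ht h hh
      · have := ht _ (IsSymmetric.mul hh' hh)
        rw [C_mul] at this
        convert this using 1
        ring
      · have hr : esymm (Fin a) (MvPolynomial (Fin b) K) r =
            PowerSeries.coeff r (cSeries K a b * PowerSeries.map C (elemSeries X)) := by
          rw [map_elemSeries, cSeries]
          change _ = PowerSeries.coeff r (_ * elemSeries (yVar K a b))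
          rw [superSeries_mul_elemSeries,
            coeff_elemSeries_eq_aeval_esymm (B := MvPolynomial (Fin b) K), aeval_X_left_apply]
        rw [hr, PowerSeries.coeff_mul, Finset.sum_mul, Finset.mul_sum, Finset.sum_mul]
        refine sum_mem fun q _ => ?_
        have := mul_mem (coeff_cSeries_mem (K := K) (a := a) (b := b) q.1)
          (ht _ (IsSymmetric.mul (isSymmetric_coeff_elemSeries q.2) hh))
        rw [C_mul] at this
        rw [PowerSeries.coeff_map]
        convert this using 1
        ring
    · have := congrArg (coeff e) (hG.2 τ)
      rw [coeff_map] at this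
      exact this
  simpa using hT 1 IsSymmetric.one

end Bisymmetric

section Nice

variable (K : Type*) [Field K] (p m n : ℕ)

/-- The algebra generated by the `c_r(x|y)` and the `σ_j(y)^p`. -/
def niceAlgebra : Subalgebra K (MvPolynomial (Fin m ⊕ Fin n) K) :=
  Algebra.adjoin K (Set.range (cpoly K m n) ∪ Set.range fun j => sigmaY K m n j ^ p)

variable {K m n}

lemma rename_eq_aeval {σ τ : Type*} (f : σ → τ) (q : MvPolynomial σ K) :
    rename f q = aeval (fun i => (X (f i) : MvPolynomial τ K)) q :=
  DFunLike.congr_fun (show rename f = aeval fun i => (X (f i) : MvPolynomial τ K) from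
    algHom_ext fun i => by simp) q

lemma cpoly_eq_coeff (r : ℕ) :
    cpoly K m n r = PowerSeries.coeff r (superSeries (fun i => X (Sum.inl i))
      fun j => (X (Sum.inr j) : MvPolynomial (Fin m ⊕ Fin n) K)) := by
  rw [superSeries, PowerSeries.coeff_mul, Finset.Nat.sum_antidiagonal_eq_sum_range_succ_mk, cpoly]
  refine (Finset.sum_congr rfl fun i _ => ?_).trans
    (Finset.sum_subset (Finset.range_subset_range.2 (by omega)) fun i hi hi' => ?_)
  · rw [coeff_elemSeries_eq_aeval_esymm (B := K), coeff_homSeries_eq_aeval_hsymm (B := K)]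
    simp only [rename_eq_aeval]
    ring
  · rw [coeff_elemSeries_of_card_lt, zero_mul]
    simp only [Finset.mem_range] at hi hi'
    rw [Fintype.card_fin]
    omega

lemma sigmaY_eq_coeff (j : ℕ) :
    sigmaY K m n j = PowerSeries.coeff j (elemSeries
      fun j => (X (Sum.inr j) : MvPolynomial (Fin m ⊕ Fin n) K)) := by
  rw [coeff_elemSeries_eq_aeval_esymm (B := K), sigmaY, rename_eq_aeval]

variable {A : Type*} [CommRing A] [Algebra K A]

lemma map_cpoly (φ : MvPolynomial (Fin m ⊕ Fin n) K →ₐ[K] A) (r : ℕ) :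
    φ (cpoly K m n r) = PowerSeries.coeff r
      (superSeries (fun i => φ (X (Sum.inl i))) fun j => φ (X (Sum.inr j))) := by
  have h := PowerSeries.coeff_map φ.toRingHom r (superSeries (fun i => X (Sum.inl i))
    fun j => (X (Sum.inr j) : MvPolynomial (Fin m ⊕ Fin n) K))
  rw [map_superSeries] at h
  rw [cpoly_eq_coeff]
  exact h.symm

lemma map_sigmaY (φ : MvPolynomial (Fin m ⊕ Fin n) K →ₐ[K] A) (r : ℕ) :
    φ (sigmaY K m n r) = PowerSeries.coeff r (elemSeries fun j => φ (X (Sum.inr j))) := by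
  have h := PowerSeries.coeff_map φ.toRingHom r (elemSeries
    fun j => (X (Sum.inr j) : MvPolynomial (Fin m ⊕ Fin n) K))
  rw [map_elemSeries] at h
  rw [sigmaY_eq_coeff]
  exact h.symm

lemma map_sigmaY_pow [Fact p.Prime] [CharP A p] (φ : MvPolynomial (Fin m ⊕ Fin n) K →ₐ[K] A)
    (r : ℕ) : φ (sigmaY K m n r ^ p) =
      PowerSeries.coeff r (elemSeries fun j => φ (X (Sum.inr j)) ^ p) := by
  rw [map_pow, map_sigmaY, ← frobenius_def (p := p), ← PowerSeries.coeff_map, map_elemSeries]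
  rfl

lemma niceAlgebra_le_adjoin_nsGens (hp : p ≠ 0) :
    niceAlgebra K p m n ≤ Algebra.adjoin K (nsGens K p m n) := by
  refine Algebra.adjoin_le ?_
  rintro _ (⟨r, rfl⟩ | ⟨j, rfl⟩)
  · exact Algebra.subset_adjoin (Or.inl (Or.inl (Or.inl ⟨r, rfl⟩)))
  · dsimp only
    rcases Nat.eq_zero_or_pos j with rfl | hj
    · simp [sigmaY, one_mem]
    by_cases hjn : j ≤ n
    · exact Algebra.subset_adjoin (Or.inl (Or.inr ⟨j, hj, hjn, rfl⟩))
    · rw [sigmaY_eq_coeff, coeff_elemSeries_of_card_lt _ (by simpa using hjn), zero_pow hp]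
      exact zero_mem _

lemma superSeries_eq_of_common {B ι κ : Type*} [CommRing B] [Fintype ι] [Fintype κ]
    [DecidableEq ι] [DecidableEq κ]
    (x : ι → B) (y : κ → B) (i : ι) (j : κ) (h : x i = y j) :
    superSeries x y = superSeries (fun l : {l // l ≠ i} => x l) fun l : {l // l ≠ j} => y l := by
  have hx : elemSeries x = (1 + PowerSeries.C (x i) * PowerSeries.X) *
      elemSeries fun l : {l // l ≠ i} => x l := Fintype.prod_eq_mul_prod_subtype_ne _ i
  have hy : homSeries y = geomSeries (y j) * homSeries fun l : {l // l ≠ j} => y l :=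
    Fintype.prod_eq_mul_prod_subtype_ne _ j
  rw [superSeries, hx, hy, mul_mul_mul_comm, h, one_add_mul_geomSeries, one_mul, superSeries]

variable (K m n)

/-- The algebra of supersymmetric polynomials. -/
def superAlgebra : Subalgebra K (MvPolynomial (Fin m ⊕ Fin n) K) where
  carrier := {f | IsSupersymmetric K m n f}
  mul_mem' := fun ⟨h₁, h₂, h₃⟩ ⟨h₁', h₂', h₃'⟩ =>
    ⟨fun σ => by rw [map_mul, h₁, h₁'], fun τ => by rw [map_mul, h₂, h₂'],
      by rw [map_mul, Polynomial.derivative_mul, h₃, h₃', zero_mul, mul_zero, add_zero]⟩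
  add_mem' := fun ⟨h₁, h₂, h₃⟩ ⟨h₁', h₂', h₃'⟩ =>
    ⟨fun σ => by rw [map_add, h₁, h₁'], fun τ => by rw [map_add, h₂, h₂'],
      by rw [map_add, map_add, h₃, h₃', add_zero]⟩
  algebraMap_mem' c :=
    ⟨fun σ => by simp [algebraMap_eq], fun τ => by simp [algebraMap_eq], by
      rw [AlgHom.commutes, IsScalarTower.algebraMap_apply K (MvPolynomial (Fin m ⊕ Fin n) K),
        Polynomial.algebraMap_eq, Polynomial.derivative_C]⟩

variable {K m n}

lemma rename_cpoly (σ : Equiv.Perm (Fin m)) (τ : Equiv.Perm (Fin n)) (r : ℕ) :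
    rename (Sum.map σ τ) (cpoly K m n r) = cpoly K m n r := by
  rw [map_cpoly, cpoly_eq_coeff]
  simp only [rename_X, Sum.map_inl, Sum.map_inr]
  exact congrArg (PowerSeries.coeff r) (superSeries_comp_equiv
    (fun i => (X (Sum.inl i) : MvPolynomial (Fin m ⊕ Fin n) K)) (fun j => X (Sum.inr j)) σ τ)

lemma psiSub_inl (i : Fin m) : psiSub K m n (X (Sum.inl i)) =
    if (i : ℕ) = m - 1 then Polynomial.X else Polynomial.C (X (Sum.inl i)) := by
  rw [psiSub, aeval_X, Sum.elim_inl]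

lemma psiSub_inr (j : Fin n) : psiSub K m n (X (Sum.inr j)) =
    if (j : ℕ) = n - 1 then Polynomial.X else Polynomial.C (X (Sum.inr j)) := by
  rw [psiSub, aeval_X, Sum.elim_inr]

lemma derivative_psiSub_cpoly (hm : 1 ≤ m) (hn : 1 ≤ n) (r : ℕ) :
    Polynomial.derivative (psiSub K m n (cpoly K m n r)) = 0 := by
  have hx : (fun l : {l : Fin m // l ≠ ⟨m - 1, by omega⟩} => psiSub K m n (X (Sum.inl l))) =
      (Polynomial.C : MvPolynomial (Fin m ⊕ Fin n) K →+* _) ∘ fun l => X (Sum.inl l.1) := by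
    funext ⟨l, hl⟩
    exact (psiSub_inl l).trans (if_neg fun h => hl (Fin.ext h))
  have hy : (fun l : {l : Fin n // l ≠ ⟨n - 1, by omega⟩} => psiSub K m n (X (Sum.inr l))) =
      (Polynomial.C : MvPolynomial (Fin m ⊕ Fin n) K →+* _) ∘ fun l => X (Sum.inr l.1) := by
    funext ⟨l, hl⟩
    exact (psiSub_inr l).trans (if_neg fun h => hl (Fin.ext h))
  rw [map_cpoly, superSeries_eq_of_common _ _ ⟨m - 1, by omega⟩ ⟨n - 1, by omega⟩
    ((psiSub_inl _).trans ((if_pos rfl).trans ((psiSub_inr _).trans (if_pos rfl)).symm)),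
    hx, hy, ← map_superSeries, PowerSeries.coeff_map, Polynomial.derivative_C]

lemma niceAlgebra_le_superAlgebra [Fact p.Prime] [CharP K p] (hm : 1 ≤ m) (hn : 1 ≤ n) :
    niceAlgebra K p m n ≤ superAlgebra K m n := by
  refine Algebra.adjoin_le ?_
  rintro _ (⟨r, rfl⟩ | ⟨j, rfl⟩)
  · exact ⟨fun σ => rename_cpoly σ (Equiv.refl _) r, fun τ => rename_cpoly (Equiv.refl _) τ r,
      derivative_psiSub_cpoly hm hn r⟩
  · refine ⟨fun σ => ?_, fun τ => ?_, ?_⟩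
    · rw [map_pow, sigmaY, rename_rename]
      rfl
    · rw [map_pow, sigmaY, rename_rename]
      change rename (Sum.inr ∘ τ) _ ^ p = _
      rw [← rename_rename, rename_esymm]
      rfl
    · rw [map_pow, Polynomial.derivative_pow, CharP.cast_eq_zero, map_zero, zero_mul, zero_mul]

end Nice

section Overlap

variable {K A : Type*} [Field K] [CommRing A] [Algebra K A] {p m n : ℕ} {α β κ : Type*}
  (x : α → A) (y : β → A) (e : Fin m ≃ α ⊕ κ) (e' : Fin n ≃ β ⊕ κ)

/-- The substitution specializing the variables to the elements `x_i` and `y_j`, except that the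
variables indexed by `κ` are kept, each `x`-variable being identified with a `y`-variable. -/
def overlap : MvPolynomial (Fin m ⊕ Fin n) K →ₐ[K] MvPolynomial κ A :=
  aeval (Sum.elim (Sum.elim (C ∘ x) X ∘ e) (Sum.elim (C ∘ y) X ∘ e'))

lemma overlap_inl (i : Fin m) :
    overlap (K := K) x y e e' (X (Sum.inl i)) = Sum.elim (C ∘ x) X (e i) := by
  rw [overlap, aeval_X]
  rfl

lemma overlap_inr (j : Fin n) :
    overlap (K := K) x y e e' (X (Sum.inr j)) = Sum.elim (C ∘ y) X (e' j) := by
  rw [overlap, aeval_X]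
  rfl

lemma coeff_elemSeries_mem_map_overlap [Fact p.Prime] [CharP A p] (r : ℕ) :
    PowerSeries.coeff r (elemSeries fun j => Sum.elim (C ∘ y) X (e' j) ^ p) ∈
      (niceAlgebra K p m n).map (overlap x y e e') := by
  refine ⟨sigmaY K m n r ^ p, Algebra.subset_adjoin (Or.inr ⟨r, rfl⟩), ?_⟩
  refine (map_sigmaY_pow p (overlap x y e e') r).trans ?_
  simp only [overlap_inr]

variable [Fintype α] [Fintype β]

lemma overlap_cpoly [Fintype κ] (r : ℕ) :
    overlap x y e e' (cpoly K m n r) = C (PowerSeries.coeff r (superSeries x y)) := by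
  rw [map_cpoly]
  simp only [overlap_inl, overlap_inr]
  rw [← PowerSeries.coeff_map, map_superSeries]
  exact congrArg _ ((superSeries_comp_equiv (Sum.elim (C ∘ x) X) (Sum.elim (C ∘ y) X) e e').trans
    (superSeries_sumElim _ _ _))

lemma C_mem_map_overlap [Fintype κ] {c : A}
    (hc : c ∈ Algebra.adjoin K (Set.range fun r => PowerSeries.coeff r (superSeries x y))) :
    C c ∈ (niceAlgebra K p m n).map (overlap x y e e') := by
  have h : Algebra.adjoin K (Set.range fun r => PowerSeries.coeff r (superSeries x y)) ≤
      ((niceAlgebra K p m n).map (overlap x y e e')).comap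
        (IsScalarTower.toAlgHom K A (MvPolynomial κ A)) := by
    refine Algebra.adjoin_le ?_
    rintro _ ⟨r, rfl⟩
    exact ⟨cpoly K m n r, Algebra.subset_adjoin (Or.inl ⟨r, rfl⟩), overlap_cpoly x y e e' r⟩
  exact h hc

/-- The elementary symmetric polynomials in the `p`-th powers of the retained variables, in terms
of all the `y`-variables. -/
lemma expand_esymm [Fintype κ] (q r : ℕ) : expand q (esymm κ A r) =
    PowerSeries.coeff r (elemSeries (fun j => Sum.elim (C ∘ y) X (e' j) ^ q) *
      PowerSeries.map C (homSeries fun j => y j ^ q)) := by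
  have h : (fun j => Sum.elim (C ∘ y) X (e' j) ^ q) =
      Sum.elim (C ∘ fun j => y j ^ q) (fun t => (X t : MvPolynomial κ A) ^ q) ∘ e' := by
    funext j
    simp only [Function.comp_apply]
    rcases e' j with i | t <;> simp
  rw [h, elemSeries_comp_equiv, elemSeries_sumElim, map_homSeries, mul_right_comm,
    elemSeries_mul_homSeries, one_mul, coeff_elemSeries_eq_aeval_esymm (B := A)]
  rfl

lemma C_mul_expand_mem [Fact p.Prime] [CharP A p] {k : ℕ} (e : Fin m ≃ α ⊕ Fin k)
    (e' : Fin n ≃ β ⊕ Fin k) {D : A}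
    (S : Subring A) (hD : ∀ s ∈ S, D * s ∈
      Algebra.adjoin K (Set.range fun r => PowerSeries.coeff r (superSeries x y)))
    (hS : ∀ r, PowerSeries.coeff r (homSeries fun j => y j ^ p) ∈ S)
    {G : MvPolynomial (Fin k) A} (hG : G.IsSymmetric) (hc : ∀ d, coeff d G ∈ S) :
    C D * expand p G ∈ (niceAlgebra K p m n).map (overlap x y e e') := by
  let T : AddSubgroup (MvPolynomial (Fin k) A) :=
    { carrier := {g | ∀ s ∈ S,
        C (D * s) * expand p g ∈ (niceAlgebra K p m n).map (overlap x y e e')}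
      add_mem' := fun hg hg' s hs => by
        rw [map_add, mul_add]; exact add_mem (hg s hs) (hg' s hs)
      zero_mem' := fun s _ => by simp [zero_mem]
      neg_mem' := fun hg s hs => by
        have := neg_mem (hg s hs)
        rw [map_neg]
        convert this using 1
        ring }
  have hT : G ∈ T := by
    refine closure_le_of_mul_mem T ?_ ?_ (mem_closure_esymm S hG hc)
    · intro s hs
      rw [map_one, mul_one]
      exact C_mem_map_overlap x y e e' (hD s hs)
    · rintro _ (⟨s', hs', rfl⟩ | ⟨r, rfl⟩) t ht s hs
      · have := ht _ (mul_mem hs hs')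
        rw [map_mul (expand p), expand_C]
        convert this using 1
        rw [C_mul, C_mul, C_mul]
        ring
      · rw [map_mul (expand p), expand_esymm y e', PowerSeries.coeff_mul, Finset.sum_mul,
          Finset.mul_sum]
        refine sum_mem fun q _ => ?_
        have := mul_mem (coeff_elemSeries_mem_map_overlap (K := K) (p := p) x y e e' q.1)
          (ht _ (mul_mem hs (hS q.2)))
        rw [PowerSeries.coeff_map]
        rw [C_mul, C_mul] at this
        rw [C_mul]
        convert this using 1
        ring
  simpa using hT 1 (one_mem _)

end Overlap

section Invariance

variable {K : Type*} [Field K] {m n : ℕ} {f : MvPolynomial (Fin m ⊕ Fin n) K}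
  {B B' : Type*} [CommRing B] [Algebra K B] [CommRing B'] [Algebra K B']

lemma map_aeval_sumElim (φ : B →+* B') (hφ : ∀ c : K, φ (algebraMap K B c) = algebraMap K B' c)
    (u : Fin m → B) (v : Fin n → B) (f : MvPolynomial (Fin m ⊕ Fin n) K) :
    φ (aeval (Sum.elim u v) f) = aeval (Sum.elim (fun i => φ (u i)) fun j => φ (v j)) f := by
  let ψ : B →ₐ[K] B' := { φ with commutes' := hφ }
  have h : ψ.comp (aeval (Sum.elim u v)) =
      aeval (Sum.elim (fun i => φ (u i)) fun j => φ (v j)) := by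
    refine algHom_ext ?_
    rintro (i | j) <;> simp [ψ]
  exact DFunLike.congr_fun h f

lemma _root_.IsSupersymmetric.aeval_perm (hf : IsSupersymmetric K m n f) (u : Fin m → B)
    (v : Fin n → B) (σ : Equiv.Perm (Fin m)) (τ : Equiv.Perm (Fin n)) :
    aeval (Sum.elim (u ∘ σ) (v ∘ τ)) f = aeval (Sum.elim u v) f := by
  conv_rhs => rw [← hf.1 σ, ← hf.2.1 τ, rename_rename, aeval_rename]
  congr 2
  ext (i | j) <;> rfl

lemma derivation_aeval_eq_zero {σ : Type*} (D : Derivation K B B) {g : σ → B}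
    (hg : ∀ i, D (g i) = 0) (q : MvPolynomial σ K) : D (aeval g q) = 0 := by
  induction q using MvPolynomial.induction_on with
  | C c => rw [aeval_C, Derivation.map_algebraMap]
  | add q r hq hr => rw [map_add, map_add, hq, hr, add_zero]
  | mul_X q i hq =>
    rw [map_mul, aeval_X, Derivation.leibniz, hq, hg, smul_zero, smul_zero, add_zero]

lemma derivation_eval₂ {R : Type*} [CommRing R] (D : Derivation K B B) (χ : R →+* B)
    (hχ : ∀ r, D (χ r) = 0) (T : B) (q : Polynomial R) :
    D (q.eval₂ χ T) = (Polynomial.derivative q).eval₂ χ T * D T := by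
  induction q using Polynomial.induction_on' with
  | add q r hq hr =>
    rw [Polynomial.eval₂_add, map_add, hq, hr, map_add, Polynomial.eval₂_add, add_mul]
  | monomial l c =>
    rw [Polynomial.eval₂_monomial, Derivation.leibniz, hχ, Derivation.leibniz_pow,
      Polynomial.derivative_monomial, Polynomial.eval₂_monomial]
    simp only [smul_eq_mul, nsmul_eq_mul, map_mul, map_natCast]
    ring

lemma _root_.IsSupersymmetric.derivation_aeval (hf : IsSupersymmetric K m n f)
    (D : Derivation K B B) (u : Fin m → B) (v : Fin n → B) (i₀ : Fin m) (j₀ : Fin n)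
    (h : u i₀ = v j₀) (hu : ∀ i ≠ i₀, D (u i) = 0) (hv : ∀ j ≠ j₀, D (v j) = 0) :
    D (aeval (Sum.elim u v) f) = 0 := by
  have hm := i₀.pos
  have hn := j₀.pos
  let i₁ : Fin m := ⟨m - 1, by omega⟩
  let j₁ : Fin n := ⟨n - 1, by omega⟩
  rw [← hf.aeval_perm u v (Equiv.swap i₁ i₀) (Equiv.swap j₁ j₀)]
  set u' := u ∘ Equiv.swap i₁ i₀ with hu'
  set v' := v ∘ Equiv.swap j₁ j₀ with hv'
  let χ : MvPolynomial (Fin m ⊕ Fin n) K →ₐ[K] B := aeval (Sum.elim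
    (fun i => if (i : ℕ) = m - 1 then 0 else u' i) fun j => if (j : ℕ) = n - 1 then 0 else v' j)
  have hT : v' j₁ = u' i₁ := by simp [hu', hv', h]
  have hχ (r) : D (χ r) = 0 := by
    refine derivation_aeval_eq_zero D ?_ r
    rintro (i | j) <;> simp only [Sum.elim_inl, Sum.elim_inr] <;> split_ifs with hi
    · exact map_zero D
    · refine hu _ fun hi' => hi ?_
      rw [Equiv.swap_apply_eq_iff, Equiv.swap_apply_right] at hi'
      rw [hi']
    · exact map_zero D
    · refine hv _ fun hi' => hi ?_
      rw [Equiv.swap_apply_eq_iff, Equiv.swap_apply_right] at hi'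
      rw [hi']
  have key : aeval (Sum.elim u' v') f = (psiSub K m n f).eval₂ χ.toRingHom (u' i₁) := by
    have : (aeval (Sum.elim u' v') : MvPolynomial (Fin m ⊕ Fin n) K →ₐ[K] B).toRingHom =
        (Polynomial.eval₂RingHom χ.toRingHom (u' i₁)).comp (psiSub K m n).toRingHom := by
      refine ringHom_ext (fun c => ?_) ?_
      · have h1 : psiSub K m n (C c) = Polynomial.C (C c) := (psiSub K m n).commutes c
        have h2 : χ (C c) = algebraMap K B c := χ.commutes c
        simp [h1, h2]
      · rintro (i | j)
        · have h1 := psiSub_inl (K := K) (n := n) i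
          by_cases hi : (i : ℕ) = m - 1
          · obtain rfl : i = i₁ := Fin.ext hi
            rw [if_pos hi] at h1
            simp [h1]
          · rw [if_neg hi] at h1
            simp [h1, χ, hi]
        · have h1 := psiSub_inr (K := K) (m := m) j
          by_cases hj : (j : ℕ) = n - 1
          · obtain rfl : j = j₁ := Fin.ext hj
            rw [if_pos hj] at h1
            simp [h1, hT]
          · rw [if_neg hj] at h1
            simp [h1, χ, hj]
    exact DFunLike.congr_fun this f
  rw [key, derivation_eval₂ D _ hχ, hf.2.2, Polynomial.eval₂_zero, zero_mul]

variable {A : Type*} [CommRing A] [Algebra K A] {α β κ : Type*} {x : α → A} {y : β → A}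
  (e : Fin m ≃ α ⊕ κ) (e' : Fin n ≃ β ⊕ κ)

lemma pderiv_overlap (hf : IsSupersymmetric K m n f) (t : κ) :
    pderiv t (overlap x y e e' f) = 0 := by
  classical
  refine hf.derivation_aeval (B := MvPolynomial κ A) (Derivation.restrictScalars K (pderiv t)) _ _
    (e.symm (Sum.inr t)) (e'.symm (Sum.inr t)) (by simp) (fun i hi => ?_) fun j hj => ?_
  · rw [Ne, Equiv.eq_symm_apply] at hi
    simp only [Function.comp_apply, Derivation.restrictScalars_apply]
    generalize e i = s at hi
    rcases s with s | s
    · simp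
    · simp [pderiv_X_of_ne (show s ≠ t by simpa using hi)]
  · rw [Ne, Equiv.eq_symm_apply] at hj
    simp only [Function.comp_apply, Derivation.restrictScalars_apply]
    generalize e' j = s at hj
    rcases s with s | s
    · simp
    · simp [pderiv_X_of_ne (show s ≠ t by simpa using hj)]

lemma rename_map_overlap (hf : IsSupersymmetric K m n f) (g : A →+* A)
    (hg : ∀ c : K, g (algebraMap K A c) = algebraMap K A c) (σ : Equiv.Perm α)
    (τ : Equiv.Perm β) (ρ : Equiv.Perm κ) (hx : ∀ i, g (x i) = x (σ i))
    (hy : ∀ j, g (y j) = y (τ j)) :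
    rename ρ (map g (overlap x y e e' f)) = overlap x y e e' f := by
  refine (map_aeval_sumElim ((rename ρ : MvPolynomial κ A →ₐ[A] _).toRingHom.comp (map g))
    (fun c => ?_) _ _ f).trans ?_
  · rw [IsScalarTower.algebraMap_apply K A (MvPolynomial κ A)]
    simp [algebraMap_eq, hg]
  · refine Eq.trans ?_ (hf.aeval_perm _ _
      ((e.trans (Equiv.sumCongr σ ρ)).trans e.symm) ((e'.trans (Equiv.sumCongr τ ρ)).trans e'.symm))
    congr 3
    · funext i
      simp only [Function.comp_apply, Equiv.trans_apply, Equiv.apply_symm_apply]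
      rcases e i with s | s <;> simp [hx]
    · funext j
      simp only [Function.comp_apply, Equiv.trans_apply, Equiv.apply_symm_apply]
      rcases e' j with s | s <;> simp [hy]

lemma isSymmetric_overlap (hf : IsSupersymmetric K m n f) :
    (overlap x y e e' f).IsSymmetric := fun ρ => by
  have h := rename_map_overlap (x := x) (y := y) e e' hf (RingHom.id A) (fun _ => rfl)
    (Equiv.refl _) (Equiv.refl _) ρ (fun _ => rfl) fun _ => rfl
  rwa [MvPolynomial.map_id] at h

lemma coeff_overlap (hf : IsSupersymmetric K m n f) (g : A →+* A)
    (hg : ∀ c : K, g (algebraMap K A c) = algebraMap K A c) (σ : Equiv.Perm α)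
    (τ : Equiv.Perm β) (hx : ∀ i, g (x i) = x (σ i)) (hy : ∀ j, g (y j) = y (τ j)) (d : κ →₀ ℕ) :
    g (coeff d (overlap x y e e' f)) = coeff d (overlap x y e e' f) := by
  have h := rename_map_overlap e e' hf g hg σ τ (Equiv.refl _) hx hy
  rw [Equiv.coe_refl, rename_id_apply] at h
  rw [← coeff_map, h]

end Invariance

section Filtration

lemma exists_eq_C_mul_expand {A : Type*} [CommRing A] [IsDomain A] {p : ℕ} (hp : p ≠ 0)
    [CharP A p] {κ : Type*} {F : MvPolynomial κ A} {D : A} (hD : D ≠ 0) (hF : F.IsSymmetric)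
    (hder : ∀ t, pderiv t F = 0) (hdvd : ∀ d, D ∣ coeff d F) :
    ∃ G : MvPolynomial κ A, F = C D * expand p G ∧ G.IsSymmetric ∧
      ∀ d, D * coeff d G = coeff (p • d) F := by
  obtain ⟨G, rfl⟩ := C_dvd_iff_dvd_coeff D F |>.2 hdvd
  have hD' : (C D : MvPolynomial κ A) ≠ 0 := by simpa using hD
  obtain ⟨G, rfl⟩ := exists_expand_eq p (G := G) fun t => by
    have := hder t
    rw [Derivation.leibniz, pderiv_C, smul_zero, add_zero, smul_eq_mul] at this
    exact (mul_eq_zero.1 this).resolve_left hD'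
  refine ⟨G, rfl, fun τ => ?_, fun d => by rw [coeff_C_mul, coeff_expand_smul _ hp]⟩
  have h := hF τ
  rw [map_mul (rename τ), rename_C] at h
  have h' := mul_left_cancel₀ hD' h
  rw [rename_expand] at h'
  exact expand_injective (Nat.pos_of_ne_zero hp) h'

lemma mem_bisymmetric_of_mul_mem {K : Type*} [Field K] {a b : ℕ}
    {D G : MvPolynomial (Fin a) (MvPolynomial (Fin b) K)} (hD0 : D ≠ 0)
    (hD : D ∈ bisymmetric K a b) (h : D * G ∈ bisymmetric K a b) : G ∈ bisymmetric K a b := by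
  refine ⟨fun σ => mul_left_cancel₀ hD0 ?_, fun τ => mul_left_cancel₀ hD0 ?_⟩
  · conv_lhs => rw [← hD.1 σ, ← map_mul, h.1 σ]
  · conv_lhs => rw [← hD.2 τ, ← map_mul, h.2 τ]

universe u

variable {K : Type u} [Field K] {m n : ℕ} {f g : MvPolynomial (Fin m ⊕ Fin n) K} {a b k : ℕ}

/-- `f` vanishes whenever `k` of the `x_i` agree with `k` of the `y_j`. -/
def VanishesOnOverlap (k : ℕ) (f : MvPolynomial (Fin m ⊕ Fin n) K) : Prop :=
  ∀ (B : Type u) [CommRing B] [Algebra K B] (x : Fin m → B) (y : Fin n → B)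
    (ι : Fin k ↪ Fin m) (ι' : Fin k ↪ Fin n), (∀ t, x (ι t) = y (ι' t)) →
      aeval (Sum.elim x y) f = 0

lemma coeff_overlap_mem_bisymmetric (hf : IsSupersymmetric K m n f) (e : Fin m ≃ Fin a ⊕ Fin k)
    (e' : Fin n ≃ Fin b ⊕ Fin k) (d : Fin k →₀ ℕ) :
    coeff d (overlap (xVar K a b) (yVar K a b) e e' f) ∈ bisymmetric K a b := by
  refine ⟨fun σ => ?_, fun τ => ?_⟩
  · refine coeff_overlap e e' hf (rename σ : _ →ₐ[MvPolynomial (Fin b) K]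
      MvPolynomial (Fin a) (MvPolynomial (Fin b) K)).toRingHom (fun c => ?_) σ (Equiv.refl _)
      (fun i => ?_) (fun j => ?_) d
    · exact rename_C σ (C c)
    · exact rename_X σ i
    · exact rename_C σ (X j)
  · refine coeff_overlap e e' hf (map (rename τ : _ →ₐ[K] MvPolynomial (Fin b) K).toRingHom)
      (fun c => ?_) (Equiv.refl _) τ (fun i => ?_) (fun j => ?_) d
    · refine (map_C _ _).trans (congrArg _ ?_)
      exact rename_C τ c
    · exact map_X _ i
    · refine (map_C _ _).trans (congrArg _ ?_)
      exact rename_X τ j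

lemma diffProd_dvd_coeff_overlap (hv : VanishesOnOverlap (k + 1) f)
    (e : Fin m ≃ Fin a ⊕ Fin k) (e' : Fin n ≃ Fin b ⊕ Fin k) (d : Fin k →₀ ℕ) :
    diffProd K a b ∣ coeff d (overlap (xVar K a b) (yVar K a b) e e' f) := by
  refine prod_X_sub_C_dvd (X_injective (R := K)) fun i j => ?_
  have h : map (substVar i (X j : MvPolynomial (Fin b) K)).toRingHom
      (overlap (xVar K a b) (yVar K a b) e e' f) = 0 := by
    refine (map_aeval_sumElim _ (fun c => ?_) _ _ f).trans ?_
    · refine (map_C _ _).trans (congrArg _ ?_)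
      exact aeval_C _ _
    · refine hv _ _ _ ⟨Fin.cons (e.symm (Sum.inl i)) (e.symm ∘ Sum.inr),
        Fin.cons_injective_iff.2 ⟨by simp, e.symm.injective.comp Sum.inr_injective⟩⟩
        ⟨Fin.cons (e'.symm (Sum.inl j)) (e'.symm ∘ Sum.inr),
        Fin.cons_injective_iff.2 ⟨by simp, e'.symm.injective.comp Sum.inr_injective⟩⟩ fun t => ?_
      refine Fin.cases ?_ (fun t => ?_) t
      · simp [xVar, yVar, substVar]
      · simp
  have := congrArg (coeff d) h
  rw [coeff_map, coeff_zero] at this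
  exact this

lemma overlap_mem_map (p : ℕ) [Fact p.Prime] [CharP K p] (hf : IsSupersymmetric K m n f)
    (hv : VanishesOnOverlap (k + 1) f) (e : Fin m ≃ Fin a ⊕ Fin k) (e' : Fin n ≃ Fin b ⊕ Fin k) :
    overlap (xVar K a b) (yVar K a b) e e' f ∈
      (niceAlgebra K p m n).map (overlap (xVar K a b) (yVar K a b) e e') := by
  obtain ⟨G, hG, hsym, hc⟩ := exists_eq_C_mul_expand (Fact.out : p.Prime).ne_zero
    diffProd_ne_zero (isSymmetric_overlap e e' hf) (pderiv_overlap e e' hf)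
    (diffProd_dvd_coeff_overlap hv e e')
  rw [hG]
  refine C_mul_expand_mem _ _ e e' (bisymmetric K a b) (fun s hs => diffProd_mul_mem hs)
    (fun r => ?_) hsym fun d => mem_bisymmetric_of_mul_mem diffProd_ne_zero
      diffProd_mem_bisymmetric (hc d ▸ coeff_overlap_mem_bisymmetric hf e e' _)
  refine ⟨fun σ => ?_, fun τ => ?_⟩
  · have := PowerSeries.coeff_map (rename σ :
      MvPolynomial (Fin a) (MvPolynomial (Fin b) K) →ₐ[_] _).toRingHom r
      (homSeries fun j => yVar K a b j ^ p)
    rw [map_homSeries] at this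
    refine this.symm.trans (congrArg _ (congrArg _ (funext fun j => ?_)))
    simp
  · have := PowerSeries.coeff_map (map (σ := Fin a)
      (rename τ : MvPolynomial (Fin b) K →ₐ[K] MvPolynomial (Fin b) K).toRingHom) r
      (homSeries fun j => yVar K a b j ^ p)
    rw [map_homSeries] at this
    refine this.symm.trans (congrArg _ ?_)
    refine Eq.trans (congrArg _ (funext fun j => ?_))
      (homSeries_comp_equiv (fun j => yVar K a b j ^ p) τ)
    simp

lemma map_overlap {A B α β κ : Type*} [CommRing A] [Algebra K A] [CommRing B] [Algebra K B]
    {x : α → A} {y : β → A} (e : Fin m ≃ α ⊕ κ) (e' : Fin n ≃ β ⊕ κ) (θ : MvPolynomial κ A →+* B)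
    (hθ : ∀ c : K, θ (C (algebraMap K A c)) = algebraMap K B c)
    (f : MvPolynomial (Fin m ⊕ Fin n) K) :
    θ (overlap x y e e' f) = aeval (Sum.elim (fun i => θ (Sum.elim (C ∘ x) X (e i)))
      fun j => θ (Sum.elim (C ∘ y) X (e' j))) f :=
  map_aeval_sumElim θ hθ _ _ f

lemma exists_perm_comp_eq {α : Type*} {k : ℕ} (ι ι' : Fin k ↪ α) :
    ∃ σ : Equiv.Perm α, ∀ t, σ (ι t) = ι' t := by
  have := Equiv.Perm.isMultiplyPretransitive α k
  obtain ⟨σ, hσ⟩ := MulAction.exists_smul_eq (Equiv.Perm α) ι ι'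
  exact ⟨σ, fun t => DFunLike.congr_fun hσ t⟩

lemma vanishesOnOverlap_of_overlap_eq_zero (hf : IsSupersymmetric K m n f)
    (e : Fin m ≃ Fin a ⊕ Fin k) (e' : Fin n ≃ Fin b ⊕ Fin k)
    (h : overlap (xVar K a b) (yVar K a b) e e' f = 0) : VanishesOnOverlap k f := by
  intro B _ _ x y ι ι' hxy
  obtain ⟨σ, hσ⟩ := exists_perm_comp_eq (Function.Embedding.inr.trans e.symm.toEmbedding) ι
  obtain ⟨τ, hτ⟩ := exists_perm_comp_eq (Function.Embedding.inr.trans e'.symm.toEmbedding) ι'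
  have hσ' (t) : σ (e.symm (Sum.inr t)) = ι t := hσ t
  have hτ' (t) : τ (e'.symm (Sum.inr t)) = ι' t := hτ t
  let θ : MvPolynomial (Fin k) (MvPolynomial (Fin a) (MvPolynomial (Fin b) K)) →+* B :=
    eval₂Hom (eval₂Hom (eval₂Hom (algebraMap K B) fun j => y (τ (e'.symm (Sum.inl j))))
      fun i => x (σ (e.symm (Sum.inl i)))) fun t => x (ι t)
  rw [← hf.aeval_perm x y σ τ]
  refine Eq.trans ?_ ((map_overlap e e' θ (fun c => ?_) f).symm.trans
    ((congrArg θ h).trans (map_zero θ)))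
  · congr 3
    · funext i
      obtain ⟨s, rfl⟩ := e.symm.surjective i
      rcases s with s | s
      · simp [θ, xVar]
      · simp [θ, hσ']
    · funext i
      obtain ⟨s, rfl⟩ := e'.symm.surjective i
      rcases s with s | s
      · simp [θ, yVar]
      · simp [θ, hτ', hxy]
  · exact (eval₂_C _ _ _).trans ((eval₂_C _ _ _).trans (eval₂_C _ _ _))

lemma mem_niceAlgebra_of_vanishesOnOverlap (p : ℕ) [Fact p.Prime] [CharP K p] (hm : 1 ≤ m)
    (hn : 1 ≤ n) (k : ℕ) :
    ∀ f : MvPolynomial (Fin m ⊕ Fin n) K, IsSupersymmetric K m n f → VanishesOnOverlap k f →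
      f ∈ niceAlgebra K p m n := by
  induction k with
  | zero =>
    intro f hf hv
    have h := hv (MvPolynomial (Fin m ⊕ Fin n) K) (fun i => X (Sum.inl i)) (fun j => X (Sum.inr j))
      Function.Embedding.ofIsEmpty Function.Embedding.ofIsEmpty (fun t => t.elim0)
    have h' : (Sum.elim (fun i => X (Sum.inl i)) fun j => X (Sum.inr j)) =
        (X : _ → MvPolynomial (Fin m ⊕ Fin n) K) := by
      ext1 (i | j) <;> rfl
    rw [h', aeval_X_left_apply] at h
    rw [h]
    exact zero_mem _
  | succ k ih =>
    intro f hf hv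
    by_cases hk : k ≤ m ∧ k ≤ n
    · have e : Fin m ≃ Fin (m - k) ⊕ Fin k :=
        (finCongr (Nat.sub_add_cancel hk.1).symm).trans finSumFinEquiv.symm
      have e' : Fin n ≃ Fin (n - k) ⊕ Fin k :=
        (finCongr (Nat.sub_add_cancel hk.2).symm).trans finSumFinEquiv.symm
      obtain ⟨g, hg, hgf⟩ := overlap_mem_map p hf hv e e'
      have hsub : f - g ∈ superAlgebra K m n :=
        (superAlgebra K m n).sub_mem hf (niceAlgebra_le_superAlgebra p hm hn hg)
      have hfg := ih (f - g) hsub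
        (vanishesOnOverlap_of_overlap_eq_zero hsub e e' (by
          rw [map_sub]; exact sub_eq_zero.2 hgf.symm))
      have := add_mem hfg hg
      rwa [sub_add_cancel] at this
    · refine ih f hf fun B _ _ x y ι ι' _ => absurd ⟨?_, ?_⟩ hk
      · simpa using Fintype.card_le_of_embedding ι
      · simpa using Fintype.card_le_of_embedding ι'

/-- Every supersymmetric polynomial is nice. -/
theorem _root_.IsSupersymmetric.mem_niceAlgebra (p : ℕ) [Fact p.Prime] [CharP K p] (hm : 1 ≤ m)
    (hn : 1 ≤ n) (hf : IsSupersymmetric K m n f) : f ∈ niceAlgebra K p m n := by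
  refine mem_niceAlgebra_of_vanishesOnOverlap p hm hn (m + 1) f hf fun B _ _ x y ι ι' _ => ?_
  exact absurd (Fintype.card_le_of_embedding ι) (by simp)

end Filtration

end Supersymmetric

end

noncomputable section

/-- **Lemma 2.1.** If a supersymmetric polynomial `f ∈ A_s(m|n)` is divisible by `x_m`,
then `f` is divisible by a nonconstant element of `A_ns(m|n)`. -/
theorem dvd_nonconstant_nice (K : Type*) [Field K] [IsAlgClosed K]
    (p : ℕ) [CharP K p] (hp : 2 < p) (m n : ℕ) (hm : 1 ≤ m) (hn : 1 ≤ n)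
    (f : MvPolynomial (Fin m ⊕ Fin n) K) (hf : IsSupersymmetric K m n f)
    (hdvd : MvPolynomial.X (Sum.inl (⟨m - 1, by omega⟩ : Fin m)) ∣ f) :
    ∃ g ∈ Algebra.adjoin K (nsGens K p m n),
      (¬ ∃ c : K, g = MvPolynomial.C c) ∧ g ∣ f := by
  have : Fact p.Prime := ⟨(CharP.char_is_prime_or_zero K p).resolve_right (by omega)⟩
  have hp0 : p ≠ 0 := by omega
  by_cases h0 : f = 0
  · refine ⟨sigmaX K m n m ^ p,
      Algebra.subset_adjoin (Or.inl (Or.inl (Or.inr ⟨m, hm, le_rfl, rfl⟩))),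
      ?_, h0 ▸ dvd_zero _⟩
    rintro ⟨c, hc⟩
    have h (t : K) : t ^ (m * p) = c := by
      have h := congrArg (eval fun _ => t) hc
      have huniv : Finset.powersetCard m (Finset.univ : Finset (Fin m)) = {Finset.univ} := by
        have h' := Finset.powersetCard_self (Finset.univ : Finset (Fin m))
        rwa [Finset.card_univ, Fintype.card_fin] at h'
      simpa [sigmaX, esymm, huniv, ← pow_mul] using h
    have h1 := (h 0).trans (h 1).symm
    rw [zero_pow (mul_ne_zero (by omega) hp0), one_pow] at h1
    exact zero_ne_one h1
  · refine ⟨f, Supersymmetric.niceAlgebra_le_adjoin_nsGens p hp0 (hf.mem_niceAlgebra p hm hn),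
      ?_, dvd_rfl⟩
    rintro ⟨c, rfl⟩
    obtain ⟨q, hq⟩ := hdvd
    have h := congrArg (eval 0) hq
    rw [eval_C, map_mul, eval_X, Pi.zero_apply, zero_mul] at h
    exact h0 (by rw [h, C_0])

end
end

section
/- Let K be an algebraically closed field of characteristic p > 2 and m, n ≥ 1. For each integer k with 0 < k < p there exists a homogeneous polynomial v_k ∈ A_ns(m|n) of degree (m−1)k + (p−k)n such that the evaluation of v_k at x_m = 0 equals u_k(m−1|n) = σ_{m−1}(x_1,…,x_{m−1})^k σ_n(y_1,…,y_n)^{p−k}. -/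
open MvPolynomial

noncomputable section

/-- The substitution `x_m = 0` (all other variables are kept). -/
def evalXm0 (K : Type*) [CommSemiring K] (m n : ℕ) :
    MvPolynomial (Fin m ⊕ Fin n) K →ₐ[K] MvPolynomial (Fin m ⊕ Fin n) K :=
  MvPolynomial.aeval (Sum.elim
    (fun i : Fin m => if (i : ℕ) = m - 1 then 0 else MvPolynomial.X (Sum.inl i))
    (fun j : Fin n => MvPolynomial.X (Sum.inr j)))

section LinearFactors

variable {ι R : Type*} [Fintype ι] [CommRing R]

/-- The polynomial `∏ i, (1 + f i * T)`. -/
def linearFactorProd (f : ι → R) : Polynomial R :=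
  ∏ i, (1 + Polynomial.C (f i) * Polynomial.X)

theorem coeff_linearFactorProd (f : ι → R) (r : ℕ) :
    (linearFactorProd f).coeff r = ∑ t ∈ Finset.univ.powersetCard r, ∏ i ∈ t, f i := by
  rw [linearFactorProd, Finset.prod_one_add, Polynomial.finsetSum_coeff,
    Finset.powersetCard_eq_filter, Finset.sum_filter]
  refine Finset.sum_congr rfl fun t _ => ?_
  rw [Finset.prod_mul_distrib, Finset.prod_const, ← map_prod, Polynomial.coeff_C_mul_X_pow]
  simp only [eq_comm]

theorem coeff_linearFactorProd_of_card_lt (f : ι → R) {r : ℕ} (h : Fintype.card ι < r) :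
    (linearFactorProd f).coeff r = 0 := by
  rw [coeff_linearFactorProd, Finset.powersetCard_eq_empty.2 (by simpa using h), Finset.sum_empty]

theorem natDegree_linearFactorProd_le (f : ι → R) :
    (linearFactorProd f).natDegree ≤ Fintype.card ι :=
  Polynomial.natDegree_le_iff_coeff_eq_zero.2 fun _ h => coeff_linearFactorProd_of_card_lt f h

theorem map_linearFactorProd {S : Type*} [CommRing S] (φ : R →+* S) (f : ι → R) :
    (linearFactorProd f).map φ = linearFactorProd (φ ∘ f) := by
  simp [linearFactorProd, Polynomial.map_prod]

theorem coeff_prod_geometric [DecidableEq ι] (f : ι → R) (r : ℕ) :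
    PowerSeries.coeff r (∏ i, PowerSeries.mk fun k => f i ^ k) =
      ∑ s : Sym ι r, (s.1.map f).prod := by
  rw [PowerSeries.coeff_prod]
  symm
  refine Finset.sum_bij (fun s _ => Multiset.toFinsupp s.1) ?_ ?_ ?_ ?_
  · intro s _
    rw [Finset.mem_finsuppAntidiag]
    refine ⟨?_, Finset.subset_univ _⟩
    exact (Multiset.sum_count_eq_card fun i _ => Finset.mem_univ i).trans s.2
  · intro s _ t _ h
    exact Subtype.ext (Multiset.toFinsupp.injective h)
  · intro l hl
    rw [Finset.mem_finsuppAntidiag] at hl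
    refine ⟨⟨Finsupp.toMultiset l, ?_⟩, Finset.mem_univ _, by simp⟩
    rw [Finsupp.card_toMultiset, Finsupp.sum_fintype _ _ (by simp)]
    exact hl.1
  · intro s _
    rw [Finset.prod_multiset_map_count]
    simp only [PowerSeries.coeff_mk, Multiset.toFinsupp_apply]
    refine Finset.prod_subset (Finset.subset_univ _) fun i _ hi => ?_
    rw [Multiset.count_eq_zero.2 (by simpa using hi), pow_zero]

theorem mk_pow_mul_one_sub (a : R) :
    (PowerSeries.mk fun k => a ^ k) * (1 - PowerSeries.C a * PowerSeries.X) = 1 := by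
  ext k
  rw [mul_sub, mul_one, ← mul_assoc, map_sub]
  cases k with
  | zero => simp
  | succ k => simp [PowerSeries.coeff_succ_mul_X, PowerSeries.coeff_one, pow_succ]

theorem prod_geometric_mul_linearFactorProd_neg (f : ι → R) :
    (∏ i, PowerSeries.mk fun k => f i ^ k) * (linearFactorProd (-f) : PowerSeries R) = 1 := by
  have h : (linearFactorProd (-f) : PowerSeries R) =
      ∏ i, (1 - PowerSeries.C (f i) * PowerSeries.X) := by
    rw [linearFactorProd, ← Polynomial.coeToPowerSeries.ringHom_apply, map_prod]
    simp [sub_eq_add_neg]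
  rw [h, ← Finset.prod_mul_distrib]
  exact Finset.prod_eq_one fun i _ => mk_pow_mul_one_sub (f i)

end LinearFactors

theorem MvPolynomial.rename_esymm_eq_coeff_linearFactorProd {ι τ K : Type*} [Fintype ι]
    [CommRing K] (g : ι → τ) (r : ℕ) :
    rename g (esymm ι K r) =
      (linearFactorProd fun i => (X (g i) : MvPolynomial τ K)).coeff r := by
  simp [coeff_linearFactorProd, esymm, map_sum, map_prod]

theorem MvPolynomial.neg_one_pow_mul_rename_hsymm {ι τ K : Type*} [Fintype ι] [DecidableEq ι]
    [CommRing K] (g : ι → τ) (r : ℕ) :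
    (-1) ^ r * rename g (hsymm ι K r) =
      PowerSeries.coeff r
        (∏ i, PowerSeries.mk fun k => (-X (g i) : MvPolynomial τ K) ^ k) := by
  rw [coeff_prod_geometric, hsymm, map_sum, Finset.mul_sum]
  refine Finset.sum_congr rfl fun s _ => ?_
  have h : (fun i => -X (g i) : ι → MvPolynomial τ K) = fun i => (-1) * X (g i) := by
    funext i; ring
  rw [h, Multiset.prod_map_mul, Multiset.map_const', Multiset.prod_replicate, s.2,
    map_multiset_prod, Multiset.map_map]
  simp [Function.comp_def]

/-- Polynomials in `T` whose coefficient of `T ^ r` is homogeneous of degree `r`. -/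
def homogeneousCoeffs (σ K : Type*) [CommRing K] : Submonoid (Polynomial (MvPolynomial σ K)) where
  carrier := {F | ∀ r, (F.coeff r).IsHomogeneous r}
  one_mem' r := by
    rw [Polynomial.coeff_one]
    split_ifs with h
    · exact h ▸ isHomogeneous_one σ K
    · exact isHomogeneous_zero σ K r
  mul_mem' {F G} hF hG r := by
    rw [Polynomial.coeff_mul]
    refine IsHomogeneous.sum _ _ _ fun x hx => ?_
    rw [← Finset.HasAntidiagonal.mem_antidiagonal.1 hx]
    exact (hF x.1).mul (hG x.2)

theorem linearFactorProd_X_mem_homogeneousCoeffs {ι σ : Type*} (K : Type*) [Fintype ι]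
    [CommRing K] (g : ι → σ) :
    (linearFactorProd fun i => (X (g i) : MvPolynomial σ K)) ∈ homogeneousCoeffs σ K := by
  intro r
  rw [coeff_linearFactorProd]
  refine IsHomogeneous.sum _ _ _ fun t ht => ?_
  have := IsHomogeneous.prod t (fun i => (X (g i) : MvPolynomial σ K)) (fun _ => 1)
    fun i _ => isHomogeneous_X K (g i)
  simpa [(Finset.mem_powersetCard.1 ht).2] using this

theorem PowerSeries.mem_range_map_subalgebra_val {K R : Type*} [CommRing K] [CommRing R]
    [Algebra K R] (S : Subalgebra K R) (F : PowerSeries R) :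
    F ∈ (PowerSeries.map (S.val : S →+* R)).range ↔ ∀ r, PowerSeries.coeff r F ∈ S := by
  refine ⟨?_, fun h => ⟨PowerSeries.mk fun r => ⟨_, h r⟩, by ext; simp⟩⟩
  rintro ⟨G, rfl⟩ r
  simp

theorem cpoly_eq_coeff (K : Type*) [CommRing K] (m n r : ℕ) :
    cpoly K m n r = PowerSeries.coeff r
      (((linearFactorProd fun i : Fin m => (X (Sum.inl i) : MvPolynomial (Fin m ⊕ Fin n) K)) :
          PowerSeries (MvPolynomial (Fin m ⊕ Fin n) K)) *
        ∏ j : Fin n, PowerSeries.mk fun k =>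
          (-X (Sum.inr j) : MvPolynomial (Fin m ⊕ Fin n) K) ^ k) := by
  rw [PowerSeries.coeff_mul, Finset.Nat.sum_antidiagonal_eq_sum_range_succ_mk, cpoly]
  refine Finset.sum_subset_zero_on_sdiff (Finset.range_subset_range.2 (by omega)) ?_ ?_
  · intro i hi
    simp only [Finset.mem_sdiff, Finset.mem_range] at hi
    rw [Polynomial.coeff_coe, coeff_linearFactorProd_of_card_lt _ (by simp; omega), zero_mul]
  · intro i _
    rw [Polynomial.coeff_coe, ← rename_esymm_eq_coeff_linearFactorProd,
      ← neg_one_pow_mul_rename_hsymm]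
    ring

theorem coeff_linearFactorProd_pow_char_mem_adjoin (K : Type*) [CommRing K] (p : ℕ)
    [Fact p.Prime] [CharP K p] (m n r : ℕ) :
    ((linearFactorProd fun j : Fin n =>
        (X (Sum.inr j) : MvPolynomial (Fin m ⊕ Fin n) K)) ^ p).coeff r ∈
      Algebra.adjoin K (nsGens K p m n) := by
  set F := linearFactorProd fun j : Fin n => (X (Sum.inr j) : MvPolynomial (Fin m ⊕ Fin n) K)
    with hF
  have hdeg : F.natDegree < n + 1 := by
    simpa [Nat.lt_succ_iff] using natDegree_linearFactorProd_le
      fun j : Fin n => (X (Sum.inr j) : MvPolynomial (Fin m ⊕ Fin n) K)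
  rw [F.as_sum_range' (n + 1) hdeg,
    sum_pow_char, Polynomial.finsetSum_coeff]
  refine sum_mem fun j hj => ?_
  rw [Polynomial.monomial_pow, Polynomial.coeff_monomial]
  split_ifs
  · rw [hF, ← rename_esymm_eq_coeff_linearFactorProd]
    rcases Nat.eq_zero_or_pos j with rfl | h
    · simp [one_mem]
    · exact Algebra.subset_adjoin
        (Or.inl (Or.inr ⟨j, h, Nat.lt_succ_iff.1 (Finset.mem_range.1 hj), rfl⟩))
  · exact zero_mem _

theorem coeff_linearFactorProd_pow_mul_pow_mem_adjoin (K : Type*) [CommRing K] (p : ℕ)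
    [Fact p.Prime] [CharP K p] (m n : ℕ) {k : ℕ} (hk : k ≤ p) (r : ℕ) :
    ((linearFactorProd fun i : Fin m =>
          (X (Sum.inl i) : MvPolynomial (Fin m ⊕ Fin n) K)) ^ k *
        (linearFactorProd fun j : Fin n =>
          (X (Sum.inr j) : MvPolynomial (Fin m ⊕ Fin n) K)) ^ (p - k)).coeff r ∈
      Algebra.adjoin K (nsGens K p m n) := by
  set F := linearFactorProd fun i : Fin m => (X (Sum.inl i) : MvPolynomial (Fin m ⊕ Fin n) K)
    with hF
  set G := linearFactorProd fun j : Fin n => (X (Sum.inr j) : MvPolynomial (Fin m ⊕ Fin n) K)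
    with hG
  set H := ∏ j : Fin n, PowerSeries.mk fun k =>
    (-X (Sum.inr j) : MvPolynomial (Fin m ⊕ Fin n) K) ^ k with hH
  have hHG : H * (G : PowerSeries (MvPolynomial (Fin m ⊕ Fin n) K)) = 1 := by
    rw [hH, hG]
    convert prod_geometric_mul_linearFactorProd_neg
      fun j : Fin n => (-X (Sum.inr j) : MvPolynomial (Fin m ⊕ Fin n) K) using 4
    funext j
    simp
  have key : ((F ^ k * G ^ (p - k) : Polynomial (MvPolynomial (Fin m ⊕ Fin n) K)) :
      PowerSeries (MvPolynomial (Fin m ⊕ Fin n) K)) =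
        ((F : PowerSeries (MvPolynomial (Fin m ⊕ Fin n) K)) * H) ^ k *
          ((G ^ p : Polynomial _) : PowerSeries _) := by
    rw [Polynomial.coe_mul, Polynomial.coe_pow, Polynomial.coe_pow, Polynomial.coe_pow]
    nth_rw 2 [← Nat.add_sub_cancel' hk]
    rw [pow_add, ← mul_assoc, ← mul_pow, mul_assoc _ H, hHG, mul_one]
  rw [← Polynomial.coeff_coe, key]
  refine (PowerSeries.mem_range_map_subalgebra_val _ _).1 (mul_mem (pow_mem ?_ k) ?_) r
  · refine (PowerSeries.mem_range_map_subalgebra_val _ _).2 fun i => ?_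
    rw [← cpoly_eq_coeff]
    exact Algebra.subset_adjoin (Or.inl (Or.inl (Or.inl ⟨i, rfl⟩)))
  · refine (PowerSeries.mem_range_map_subalgebra_val _ _).2 fun i => ?_
    rw [Polynomial.coeff_coe]
    exact coeff_linearFactorProd_pow_char_mem_adjoin K p m n i

theorem map_evalXm0_linearFactorProd_inl (K : Type*) [CommRing K] {m : ℕ} (hm : 1 ≤ m) (n : ℕ) :
    (linearFactorProd fun i : Fin m => (X (Sum.inl i) : MvPolynomial (Fin m ⊕ Fin n) K)).map
        (evalXm0 K m n : _ →+* _) =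
      linearFactorProd fun i : Fin (m - 1) =>
        (X ((Sum.inl ∘ Fin.castLE (Nat.sub_le m 1)) i) : MvPolynomial (Fin m ⊕ Fin n) K) := by
  obtain ⟨m, rfl⟩ := Nat.exists_eq_add_of_le' hm
  rw [map_linearFactorProd, linearFactorProd, Fin.prod_univ_castSucc]
  have h (i : Fin m) : (i : ℕ) ≠ m := i.2.ne
  have hcast (i : Fin m) : Fin.castLE (Nat.sub_le (m + 1) 1) i = i.castSucc := rfl
  simp [evalXm0, h, hcast, linearFactorProd]

theorem map_evalXm0_linearFactorProd_inr (K : Type*) [CommRing K] (m n : ℕ) :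
    (linearFactorProd fun j : Fin n => (X (Sum.inr j) : MvPolynomial (Fin m ⊕ Fin n) K)).map
        (evalXm0 K m n : _ →+* _) =
      linearFactorProd fun j : Fin n => (X (Sum.inr j) : MvPolynomial (Fin m ⊕ Fin n) K) := by
  rw [map_linearFactorProd]
  congr 1
  funext j
  simp [evalXm0]

/-- **Proposition 2.2.** For each `0 < k < p` there is a homogeneous `v_k ∈ A_ns(m|n)` of
degree `(m−1)k + (p−k)n` with `v_k|_{x_m = 0} = u_k(m−1|n) = σ_{m−1}(x_1,…,x_{m−1})^k σ_n(y)^{p−k}`. -/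
theorem exists_vk (K : Type*) [Field K] [IsAlgClosed K]
    (p : ℕ) [CharP K p] (hp : 2 < p) (m n : ℕ) (hm : 1 ≤ m) (hn : 1 ≤ n)
    (k : ℕ) (hk0 : 0 < k) (hkp : k < p) :
    ∃ v ∈ Algebra.adjoin K (nsGens K p m n),
      v.IsHomogeneous ((m - 1) * k + (p - k) * n) ∧
      evalXm0 K m n v =
        (MvPolynomial.rename (Sum.inl ∘ Fin.castLE (Nat.sub_le m 1))
            (MvPolynomial.esymm (Fin (m - 1)) K (m - 1))) ^ k *
          (sigmaY K m n n) ^ (p - k) := by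
  have : Fact p.Prime := ⟨(CharP.char_is_prime_or_zero K p).resolve_right (by omega)⟩
  refine ⟨_, coeff_linearFactorProd_pow_mul_pow_mem_adjoin K p m n hkp.le
    ((m - 1) * k + (p - k) * n), ?_, ?_⟩
  · exact mul_mem (pow_mem (linearFactorProd_X_mem_homogeneousCoeffs K _) k)
      (pow_mem (linearFactorProd_X_mem_homogeneousCoeffs K _) (p - k)) _
  · rw [← AlgHom.coe_toRingHom, ← Polynomial.coeff_map, Polynomial.map_mul, Polynomial.map_pow,
      Polynomial.map_pow, map_evalXm0_linearFactorProd_inl K hm,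
      map_evalXm0_linearFactorProd_inr, sigmaY, rename_esymm_eq_coeff_linearFactorProd,
      rename_esymm_eq_coeff_linearFactorProd, mul_comm (m - 1)]
    have hX := natDegree_linearFactorProd_le fun i : Fin (m - 1) =>
      (X ((Sum.inl ∘ Fin.castLE (Nat.sub_le m 1)) i) : MvPolynomial (Fin m ⊕ Fin n) K)
    have hY := natDegree_linearFactorProd_le fun j : Fin n =>
      (X (Sum.inr j) : MvPolynomial (Fin m ⊕ Fin n) K)
    rw [Fintype.card_fin] at hX hY
    rw [Polynomial.coeff_mul_add_eq_of_natDegree_le (Polynomial.natDegree_pow_le_of_le k hX)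
      (Polynomial.natDegree_pow_le_of_le (p - k) hY), Polynomial.coeff_pow_of_natDegree_le hX,
      Polynomial.coeff_pow_of_natDegree_le hY]

end
end

section
/- Let A be an arbitrary commutative ring and m, n ≥ 1. The algebra of polynomials f(x_1,…,x_m,y_1,…,y_n) over A that are symmetric in the variables x_1,…,x_m and in y_1,…,y_n separately and such that f|_{x_m=y_n=T} does not depend on T (i.e., substituting x_m = T and y_n = T yields a polynomial that is constant as a polynomial in T) is generated as an A-algebra by the polynomials c_r(x|y) for r ≥ 0. -/
open MvPolynomial

noncomputable section

section Core

variable {P : Type*} [CommRing P]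

/-- The transpose of multiplication by `t` on `P[t] / ∏ (t - y_l)` in the Newton basis. -/
def newtonMatrix (y : ℕ → P) (n : ℕ) : Matrix (Fin n) (Fin n) P :=
  fun j i => if j = i then y i else if (j : ℕ) = i + 1 then 1 else 0

/-- The last standard basis vector of `Fin n → P`. -/
def lastVec (P : Type*) [CommRing P] (n : ℕ) : Fin n → P :=
  fun i => if (i : ℕ) + 1 = n then 1 else 0

/-- The vector with entries the coefficients of `t ^ (r + i - n)` in `f * ∏_{l < i} (1 - y_l t)`. -/
def newtonVec (y : ℕ → P) (f : PowerSeries P) (n r : ℕ) : Fin n → P := fun i =>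
  PowerSeries.coeff (r + i)
    (PowerSeries.X ^ n * f * ∏ l ∈ Finset.range i, (1 - PowerSeries.C (y l) * PowerSeries.X))

/-- The vector with entries the coefficients of `t ^ (r + i - n)` in `f`. -/
def coeffVec (f : PowerSeries P) (n r : ℕ) : Fin n → P := fun i =>
  PowerSeries.coeff (r + i) (PowerSeries.X ^ n * f)

lemma vecMul_newtonMatrix (y : ℕ → P) (n : ℕ) (w : Fin n → P) (i : Fin n) :
    Matrix.vecMul w (newtonMatrix y n) i =
      w i * y i + if h : (i : ℕ) + 1 < n then w ⟨i + 1, h⟩ else 0 := by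
  simp only [Matrix.vecMul, dotProduct, newtonMatrix]
  have key : ∀ j : Fin n, (w j * if j = i then y i else if (j : ℕ) = i + 1 then 1 else 0) =
      (if j = i then w j * y i else 0) + (if (j : ℕ) = i + 1 then w j else 0) := by
    intro j
    by_cases h : j = i
    · subst h; simp
    · simp [h]
  simp only [key, Finset.sum_add_distrib, Finset.sum_ite_eq', Finset.mem_univ, if_true]
  congr 1
  split_ifs with h
  · rw [Finset.sum_eq_single (⟨i + 1, h⟩ : Fin n)]
    · simp
    · intro b _ hb
      rw [if_neg]
      exact fun h' => hb (Fin.ext h')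
    · simp
  · apply Finset.sum_eq_zero
    intro j _
    rw [if_neg]
    have := j.2
    omega

lemma det_sub_newtonMatrix (y : ℕ → P) (n : ℕ) (a : P) :
    (Matrix.scalar (Fin n) a - newtonMatrix y n).det = ∏ i : Fin n, (a - y i) := by
  rw [Matrix.det_of_isLowerTriangular]
  · simp [newtonMatrix]
  · intro i j hij
    have hij' : i < j := hij
    have h1 : i ≠ j := hij'.ne
    have h2 : (i : ℕ) ≠ j + 1 := by have : (i : ℕ) < j := hij'; omega
    simp [newtonMatrix, h1, h2]

lemma lastVec_vecMul_pow (y : ℕ → P) (n p : ℕ) (i : Fin n) :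
    ((i : ℕ) + p + 1 < n → Matrix.vecMul (lastVec P n) (newtonMatrix y n ^ p) i = 0) ∧
    ((i : ℕ) + p + 1 = n → Matrix.vecMul (lastVec P n) (newtonMatrix y n ^ p) i = 1) := by
  induction p generalizing i with
  | zero =>
    simp only [pow_zero, Matrix.vecMul_one, lastVec]
    constructor
    · intro h; rw [if_neg (by omega)]
    · intro h; rw [if_pos (by omega)]
  | succ p ih =>
    rw [pow_succ, ← Matrix.vecMul_vecMul, vecMul_newtonMatrix]
    constructor
    · intro h
      rw [(ih i).1 (by omega), dif_pos (by omega), (ih _).1 (by simp only; omega)]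
      simp
    · intro h
      rw [(ih i).1 (by omega), dif_pos (by omega), (ih _).2 (by simp only; omega)]
      simp

lemma newtonVec_succ (y : ℕ → P) (f : PowerSeries P) (n r : ℕ) :
    newtonVec y f n (r + 1) = Matrix.vecMul (newtonVec y f n r) (newtonMatrix y n) +
      PowerSeries.coeff r
        (f * ∏ l ∈ Finset.range n, (1 - PowerSeries.C (y l) * PowerSeries.X)) • lastVec P n := by
  funext i
  rw [Pi.add_apply, vecMul_newtonMatrix]
  have key : PowerSeries.coeff (r + i + 1) (PowerSeries.X ^ n * f *
        ∏ l ∈ Finset.range (i + 1), (1 - PowerSeries.C (y l) * PowerSeries.X)) =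
      newtonVec y f n (r + 1) i - y i * newtonVec y f n r i := by
    rw [Finset.prod_range_succ, ← mul_assoc, mul_sub, mul_one, map_sub, ← mul_assoc,
      PowerSeries.coeff_succ_mul_X, mul_comm _ (PowerSeries.C (y i)), PowerSeries.coeff_C_mul]
    simp only [newtonVec]
    rw [show r + 1 + (i : ℕ) = r + i + 1 by omega]
  simp only [Pi.smul_apply, lastVec, smul_eq_mul]
  by_cases h : (i : ℕ) + 1 < n
  · rw [dif_pos h, if_neg (by omega), mul_zero, add_zero]
    have : newtonVec y f n r ⟨i + 1, h⟩ = PowerSeries.coeff (r + i + 1) (PowerSeries.X ^ n * f *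
        ∏ l ∈ Finset.range (i + 1), (1 - PowerSeries.C (y l) * PowerSeries.X)) := by
      simp only [newtonVec]; rw [add_assoc]
    rw [this, key]; ring
  · have hn : (i : ℕ) + 1 = n := by have := i.2; omega
    rw [dif_neg h, if_pos hn, mul_one, add_zero]
    rw [hn, add_assoc r, hn, mul_assoc, PowerSeries.coeff_X_pow_mul] at key
    rw [key]; ring

lemma newtonVec_zero (y : ℕ → P) (f : PowerSeries P) (n : ℕ) : newtonVec y f n 0 = 0 := by
  funext i
  simp only [newtonVec, mul_assoc, zero_add, PowerSeries.coeff_X_pow_mul', Pi.zero_apply]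
  rw [if_neg (by have := i.2; omega)]

lemma newtonVec_eq_sum (y : ℕ → P) (f : PowerSeries P) (n r : ℕ) :
    newtonVec y f n (r + 1) = Matrix.vecMul (lastVec P n) (∑ k ∈ Finset.range (r + 1),
      PowerSeries.coeff k
        (f * ∏ l ∈ Finset.range n, (1 - PowerSeries.C (y l) * PowerSeries.X)) •
          newtonMatrix y n ^ (r - k)) := by
  induction r with
  | zero => rw [newtonVec_succ, newtonVec_zero]; simp [Matrix.vecMul_smul]
  | succ r ih =>
    rw [newtonVec_succ, ih, Matrix.vecMul_vecMul, Finset.sum_range_succ _ (r + 1),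
      Matrix.vecMul_add, Finset.sum_mul]
    congr 1
    · congr 1
      refine Finset.sum_congr rfl fun k hk => ?_
      rw [Finset.mem_range] at hk
      rw [smul_mul_assoc, ← pow_succ, show r + 1 - k = r - k + 1 by omega]
    · simp [Matrix.vecMul_smul]

lemma coeff_mul_of_natDegree_le (f : PowerSeries P) (q : Polynomial P) (i r : ℕ)
    (hq : q.natDegree ≤ i) :
    PowerSeries.coeff (r + i) (f * (q : PowerSeries P)) =
      ∑ k ∈ Finset.range (i + 1), PowerSeries.coeff (r + k) f * q.coeff (i - k) := by
  rw [← Finset.sum_range_reflect, mul_comm, PowerSeries.coeff_mul,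
    Finset.Nat.sum_antidiagonal_eq_sum_range_succ_mk]
  symm
  apply Finset.sum_subset_zero_on_sdiff (by intro k; simp; omega)
  · intro k hk
    simp only [Finset.mem_sdiff, Finset.mem_range] at hk
    rw [Polynomial.coeff_coe, Polynomial.coeff_eq_zero_of_natDegree_lt (by omega), zero_mul]
  · intro k hk
    simp only [Finset.mem_range] at hk
    rw [Polynomial.coeff_coe, mul_comm]
    congr 2 <;> congr 1 <;> omega

lemma det_newtonVec (y : ℕ → P) (f : PowerSeries P) (n : ℕ) (a : Fin n → ℕ) :
    (Matrix.of fun k => newtonVec y f n (a k)).det =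
      (Matrix.of fun k => coeffVec f n (a k)).det := by
  set q : ℕ → Polynomial P := fun i =>
    ∏ l ∈ Finset.range i, (1 - Polynomial.C (y l) * Polynomial.X) with hq
  have hqd : ∀ i, (q i).natDegree ≤ i := by
    intro i
    refine (Polynomial.natDegree_prod_le _ _).trans ?_
    refine (Finset.sum_le_card_nsmul _ _ 1 fun l _ => ?_).trans (by simp)
    compute_degree
  have hqc : ∀ i, (q i : PowerSeries P) =
      ∏ l ∈ Finset.range i, (1 - PowerSeries.C (y l) * PowerSeries.X) := by
    intro i
    rw [hq, ← Polynomial.coeToPowerSeries.ringHom_apply, map_prod]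
    simp
  set L : Matrix (Fin n) (Fin n) P := fun j i => if (j : ℕ) ≤ i then (q i).coeff (i - j) else 0
  have hL : L.det = 1 := by
    rw [Matrix.det_of_isUpperTriangular]
    · apply Finset.prod_eq_one
      intro i _
      simp [L, hq, Polynomial.coeff_zero_eq_eval_zero, Polynomial.eval_prod]
    · intro i j hij
      have hij' : (j : ℕ) < i := hij
      exact if_neg (by omega)
  have hW : (Matrix.of fun k => newtonVec y f n (a k)) =
      (Matrix.of fun k => coeffVec f n (a k)) * L := by
    ext k i
    simp only [Matrix.mul_apply, Matrix.of_apply, newtonVec, coeffVec]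
    change _ = ∑ j : Fin n, PowerSeries.coeff (a k + j) (PowerSeries.X ^ n * f) *
      if (j : ℕ) ≤ (i : ℕ) then (q i).coeff (i - j) else 0
    rw [← hqc, coeff_mul_of_natDegree_le _ _ _ _ (hqd i)]
    rw [Fin.sum_univ_eq_sum_range (fun j => PowerSeries.coeff (a k + j) (PowerSeries.X ^ n * f) *
      if j ≤ (i : ℕ) then (q i).coeff (i - j) else 0) n]
    apply Finset.sum_subset_zero_on_sdiff
    · intro j; have := i.2; simp; omega
    · intro j hj
      simp only [Finset.mem_sdiff, Finset.mem_range] at hj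
      rw [if_neg (by omega), mul_zero]
    · intro j hj
      simp only [Finset.mem_range] at hj
      rw [if_pos (by omega)]
  rw [hW, Matrix.det_mul, hL, mul_one]

lemma coeff_prod_one_sub {ι : Type*} [Fintype ι] (x : ι → P) (k : ℕ) :
    PowerSeries.coeff k (∏ i, (1 - PowerSeries.C (x i) * PowerSeries.X)) =
      (-1) ^ k * (Finset.univ.val.map x).esymm k := by
  classical
  simp_rw [sub_eq_add_neg]
  rw [Finset.prod_one_add, map_sum, Finset.esymm_map_val, Finset.mul_sum]
  have : ∀ s : Finset ι, PowerSeries.coeff k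
      (∏ i ∈ s, -(PowerSeries.C (x i) * PowerSeries.X)) =
        if s.card = k then (-1) ^ k * ∏ i ∈ s, x i else 0 := by
    intro s
    rw [Finset.prod_neg, Finset.prod_mul_distrib, Finset.prod_const, ← map_prod, ← mul_assoc,
      PowerSeries.coeff_mul_X_pow',
      show ((-1 : PowerSeries P) ^ s.card * PowerSeries.C (∏ i ∈ s, x i))
        = PowerSeries.C ((-1) ^ s.card * ∏ i ∈ s, x i) by simp, PowerSeries.coeff_C]
    by_cases h : s.card = k
    · subst h; simp
    · rw [if_neg h]
      split_ifs
      · omega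
      · rfl
      · rfl
  simp_rw [this]
  rw [Finset.sum_ite, Finset.sum_const_zero, add_zero]
  apply Finset.sum_congr _ (fun _ _ => rfl)
  ext s; simp [Finset.mem_powersetCard]

lemma esymm_map_eq_zero {ι : Type*} [Fintype ι] (x : ι → P) {k : ℕ} (hk : Fintype.card ι < k) :
    (Finset.univ.val.map x).esymm k = 0 := by
  rw [Multiset.esymm, Multiset.powersetCard_eq_empty _ (by simpa using hk)]
  simp

/-- The minor of the Toeplitz matrix of the coefficients of `f` with rows `m + 1 + a k`. -/
def toeplitzMinor (f : PowerSeries P) (m n : ℕ) (a : Fin n → ℕ) : P :=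
  (Matrix.of fun k => coeffVec f n (m + 1 + a k)).det

section

variable {m n : ℕ} {x : Fin m → P} {y : ℕ → P} {f : PowerSeries P}

lemma newtonVec_succ_of_lt (hf : f * ∏ l ∈ Finset.range n, (1 - PowerSeries.C (y l) * PowerSeries.X)
      = ∏ i, (1 - PowerSeries.C (x i) * PowerSeries.X)) {r : ℕ} (hr : m < r) :
    newtonVec y f n (r + 1) = Matrix.vecMul (newtonVec y f n r) (newtonMatrix y n) := by
  rw [newtonVec_succ, hf, coeff_prod_one_sub, esymm_map_eq_zero _ (by simpa using hr)]
  simp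

lemma newtonVec_eq_vecMul (hf : f * ∏ l ∈ Finset.range n, (1 - PowerSeries.C (y l) * PowerSeries.X)
      = ∏ i, (1 - PowerSeries.C (x i) * PowerSeries.X)) (k : ℕ) :
    newtonVec y f n (m + 1 + k) = Matrix.vecMul (Matrix.vecMul (lastVec P n) (newtonMatrix y n ^ k))
      (Polynomial.aeval (newtonMatrix y n) (∏ i, (Polynomial.X - Polynomial.C (x i)))) := by
  induction k with
  | zero =>
    rw [add_zero, newtonVec_eq_sum, hf, pow_zero, Matrix.vecMul_one]
    congr 1
    have := Multiset.prod_X_sub_X_eq_sum_esymm (Finset.univ.val.map x)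
    rw [Multiset.map_map] at this
    change (∏ i, (Polynomial.X - Polynomial.C (x i))) = _ at this
    rw [this, map_sum]
    simp only [Multiset.card_map, Finset.card_val, Finset.card_univ, Fintype.card_fin]
    refine Finset.sum_congr rfl fun k _ => ?_
    rw [coeff_prod_one_sub]
    simp [Algebra.smul_def, mul_assoc]
  | succ k ih =>
    rw [← add_assoc, newtonVec_succ_of_lt hf (by omega), ih]
    simp only [Matrix.vecMul_vecMul]
    congr 1
    rw [pow_succ, mul_assoc, mul_assoc]
    congr 1
    have h := congrArg (Polynomial.aeval (newtonMatrix y n))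
      (mul_comm (∏ i, (Polynomial.X - Polynomial.C (x i))) Polynomial.X)
    rwa [map_mul, map_mul, Polynomial.aeval_X] at h

lemma toeplitzMinor_rectangle
    (hf : f * ∏ l ∈ Finset.range n, (1 - PowerSeries.C (y l) * PowerSeries.X)
      = ∏ i, (1 - PowerSeries.C (x i) * PowerSeries.X)) :
    toeplitzMinor f m n (fun k => n - 1 - k) = (∏ i, ∏ j : Fin n, (y j - x i)) := by
  rw [toeplitzMinor, ← det_newtonVec y]
  set U : Matrix (Fin n) (Fin n) P := Matrix.of fun k =>
    Matrix.vecMul (lastVec P n) (newtonMatrix y n ^ (n - 1 - (k : ℕ)))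
  have hU : U.det = 1 := by
    rw [Matrix.det_of_isUpperTriangular]
    · apply Finset.prod_eq_one
      intro i _
      exact (lastVec_vecMul_pow y n _ i).2 (by have := i.2; omega)
    · intro i j hij
      have hij' : (j : ℕ) < i := hij
      exact (lastVec_vecMul_pow y n _ j).1 (by have := i.2; omega)
  have hW : (Matrix.of fun k : Fin n => newtonVec y f n (m + 1 + (n - 1 - k))) = U *
      (Polynomial.aeval (newtonMatrix y n) (∏ i, (Polynomial.X - Polynomial.C (x i)))) := by
    funext k
    rw [Matrix.mul_apply_eq_vecMul]
    exact newtonVec_eq_vecMul hf _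
  rw [hW, Matrix.det_mul, hU, one_mul]
  change (Matrix.detMonoidHom.comp
    (MonoidHomClass.toMonoidHom (Polynomial.aeval (newtonMatrix y n)))) _ = _
  rw [map_prod]
  refine Finset.prod_congr rfl fun i _ => ?_
  change (Polynomial.aeval (newtonMatrix y n) (Polynomial.X - Polynomial.C (x i))).det = _
  rw [map_sub, Polynomial.aeval_X, Polynomial.aeval_C, ← neg_sub, Matrix.det_neg]
  change _ * (Matrix.scalar (Fin n) (x i) - newtonMatrix y n).det = _
  rw [det_sub_newtonMatrix, ← Finset.card_univ, ← Finset.prod_neg]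
  simp

lemma esymm_mul_toeplitzMinor_mem {A : Type*} [CommRing A] [Algebra A P] (S : Subalgebra A P)
    (hf : f * ∏ l ∈ Finset.range n, (1 - PowerSeries.C (y l) * PowerSeries.X)
      = ∏ i, (1 - PowerSeries.C (x i) * PowerSeries.X)) (a : Fin n → ℕ) (j : ℕ) :
    (Finset.univ.val.map fun j : Fin n => y j).esymm j * toeplitzMinor f m n a ∈
      Submodule.span S (Set.range (toeplitzMinor f m n)) := by
  set N := Submodule.span S (Set.range (toeplitzMinor f m n))
  by_cases hj : n < j
  · rw [esymm_map_eq_zero _ (by simpa using hj), zero_mul]; exact N.zero_mem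
  set W : (Fin n → ℕ) → Matrix (Fin n) (Fin n) P := fun a =>
    Matrix.of fun k => newtonVec y f n (m + 1 + a k) with hWdef
  have hW : ∀ a, toeplitzMinor f m n a = (W a).det := fun a => (det_newtonVec y f n _).symm
  have hT : W a * newtonMatrix y n = W (a + 1) := by
    funext k
    rw [Matrix.mul_apply_eq_vecMul]
    exact (newtonVec_succ_of_lt hf (by omega)).symm
  have hdet : (∏ j : Fin n, (Polynomial.X - Polynomial.C (y j))) * Polynomial.C (W a).det =
      ((Polynomial.X : Polynomial P) • (W a).map Polynomial.C +
        -(W (a + 1)).map Polynomial.C).det := by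
    have h1 : (∏ j : Fin n, (Polynomial.X - Polynomial.C (y j))) =
        (newtonMatrix y n).charpoly := by
      rw [Matrix.charpoly, Matrix.charmatrix]
      have := det_sub_newtonMatrix (fun l => Polynomial.C (y l)) n Polynomial.X
      rw [← this]
      congr 2
      ext i j
      simp [newtonMatrix, apply_ite Polynomial.C]
    rw [h1, Matrix.charpoly, Matrix.charmatrix, ← hT, mul_comm]
    change Polynomial.C.toFun _ * _ = _
    change Polynomial.C (W a).det * _ = _
    rw [RingHom.map_det, ← Matrix.det_mul, mul_sub, RingHom.mapMatrix_apply, Matrix.map_mul,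
      sub_eq_add_neg]
    congr 2
    ext
    simp [Matrix.mul_diagonal, mul_comm Polynomial.X]
  have hexp : ∀ k, ((∏ j : Fin n, (Polynomial.X - Polynomial.C (y j))) *
      Polynomial.C (W a).det).coeff k ∈ N := by
    intro k
    rw [hdet]
    change ((Matrix.detRowAlternating.toMultilinearMap
      ((fun r => (Polynomial.X : Polynomial P) • (W a).map Polynomial.C r) +
        fun r => -(W (a + 1)).map Polynomial.C r)).coeff k) ∈ N
    rw [MultilinearMap.map_add_univ, Polynomial.finsetSum_coeff]
    refine N.sum_mem fun s _ => ?_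
    have : s.piecewise (fun r => (Polynomial.X : Polynomial P) • (W a).map Polynomial.C r)
        (fun r => -(W (a + 1)).map Polynomial.C r) =
        fun r => (if r ∈ s then Polynomial.X else -1 : Polynomial P) •
          ((W (fun k => if k ∈ s then a k else a k + 1)).map Polynomial.C r) := by
      funext r
      by_cases hr : r ∈ s
      · simp only [hr, Finset.piecewise_eq_of_mem, if_true]
        congr 1
        funext i
        simp [hWdef, hr]
      · simp only [hr, Finset.piecewise_eq_of_notMem, not_false_eq_true, if_false, neg_smul,
          one_smul]
        congr 1
        funext i
        simp [hWdef, hr]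
    rw [this]
    change ((Matrix.of fun r i => (if r ∈ s then Polynomial.X else -1 : Polynomial P) *
      (W (fun k => if k ∈ s then a k else a k + 1)).map Polynomial.C r i).det).coeff k ∈ N
    rw [Matrix.det_mul_column, ← RingHom.mapMatrix_apply, ← RingHom.map_det, ← hW,
      Polynomial.coeff_mul_C]
    have hint : (∏ r, (if r ∈ s then Polynomial.X else -1 : Polynomial P)) =
        (∏ r, (if r ∈ s then Polynomial.X else -1 : Polynomial ℤ)).map (Int.castRingHom P) := by
      rw [Polynomial.map_prod]
      refine Finset.prod_congr rfl fun r _ => ?_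
      split_ifs <;> simp
    rw [hint, Polynomial.coeff_map, eq_intCast, ← zsmul_eq_mul]
    exact zsmul_mem (S := Submodule S P) (Submodule.subset_span (Set.mem_range_self _)) _
  have hcoeff := hexp (n - j)
  rw [Polynomial.coeff_mul_C, ← hW] at hcoeff
  have h2 : (∏ j : Fin n, (Polynomial.X - Polynomial.C (y j))).coeff (n - j) =
      (-1) ^ j * (Finset.univ.val.map fun j : Fin n => y j).esymm j := by
    have := Multiset.prod_X_sub_C_coeff (Finset.univ.val.map fun j : Fin n => y j)
      (k := n - j) (by simp)
    rw [Multiset.map_map] at this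
    change (∏ i : Fin n, (Polynomial.X - Polynomial.C (y i))).coeff _ = _ at this
    rw [this]
    simp [show n - (n - j) = j by omega]
  rw [h2, mul_assoc] at hcoeff
  rcases neg_one_pow_eq_or P j with h | h
  · simpa [h] using hcoeff
  · rw [h, neg_one_mul] at hcoeff
    exact N.neg_mem_iff.1 hcoeff

lemma toeplitzMinor_mem {A : Type*} [CommRing A] [Algebra A P] (S : Subalgebra A P)
    (hS : ∀ r, PowerSeries.coeff r f ∈ S) (a : Fin n → ℕ) : toeplitzMinor f m n a ∈ S := by
  rw [toeplitzMinor, Matrix.det_apply]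
  refine S.sum_mem fun σ _ => ?_
  rw [Units.smul_def]
  refine S.zsmul_mem (S.prod_mem fun i _ => ?_) _
  simp only [Matrix.of_apply, coeffVec, PowerSeries.coeff_X_pow_mul']
  split_ifs
  · exact hS _
  · exact S.zero_mem

end

/-- Multiplying any polynomial in the elementary symmetric polynomials of `x` and `y` by
`∏ (y_j - x_i)` gives a polynomial in the coefficients of `∏ (1 - x_i t) / ∏ (1 - y_j t)`. -/
theorem prod_sub_mul_mem {A : Type*} [CommRing A] [Algebra A P] (S : Subalgebra A P) {m n : ℕ}
    (x : Fin m → P) (y : Fin n → P) (f : PowerSeries P)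
    (hf : f * ∏ j, (1 - PowerSeries.C (y j) * PowerSeries.X)
      = ∏ i, (1 - PowerSeries.C (x i) * PowerSeries.X))
    (hS : ∀ r, PowerSeries.coeff r f ∈ S) {g : P}
    (hg : g ∈ Algebra.adjoin A (Set.range (Finset.univ.val.map x).esymm ∪
      Set.range (Finset.univ.val.map y).esymm)) :
    (∏ i, ∏ j, (y j - x i)) * g ∈ S := by
  obtain ⟨y, rfl⟩ : ∃ z : ℕ → P, y = fun j : Fin n => z j :=
    ⟨fun l => if h : l < n then y ⟨l, h⟩ else 0, by funext j; simp⟩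
  rw [Fin.prod_univ_eq_prod_range (fun l => 1 - PowerSeries.C (y l) * PowerSeries.X)] at hf
  set N := Submodule.span S (Set.range (toeplitzMinor f m n)) with hN
  have hy : ∀ j, ∀ d ∈ N, (Finset.univ.val.map fun j : Fin n => y j).esymm j * d ∈ N := by
    intro j d hd
    induction hd using Submodule.span_induction with
    | mem d hd => obtain ⟨a, rfl⟩ := hd; exact esymm_mul_toeplitzMinor_mem S hf a j
    | zero => simp
    | add d e _ _ hd he => rw [mul_add]; exact N.add_mem hd he
    | smul s d _ hd => rw [mul_smul_comm]; exact N.smul_mem _ hd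
  have hx : ∀ i, ∀ d ∈ N, (Finset.univ.val.map x).esymm i * d ∈ N := by
    intro i d hd
    have h1 := coeff_prod_one_sub x i
    have h2 := fun k => coeff_prod_one_sub (fun j : Fin n => y j) k
    rw [Fin.prod_univ_eq_prod_range (fun l => 1 - PowerSeries.C (y l) * PowerSeries.X)] at h2
    rw [← hf, PowerSeries.coeff_mul] at h1
    have h3 : (-1) ^ i * (Finset.univ.val.map x).esymm i * d ∈ N := by
      rw [← h1, Finset.sum_mul]
      refine N.sum_mem fun k _ => ?_
      rw [h2, mul_assoc, mul_assoc]
      refine N.smul_mem ⟨_, hS _⟩ ?_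
      rcases neg_one_pow_eq_or P k.2 with h | h
      · rw [h, one_mul]; exact hy _ _ hd
      · rw [h, neg_one_mul]; exact N.neg_mem (hy _ _ hd)
    rw [mul_assoc] at h3
    rcases neg_one_pow_eq_or P i with h | h
    · simpa [h] using h3
    · rw [h, neg_one_mul] at h3
      exact N.neg_mem_iff.1 h3
  have hNS : ∀ d ∈ N, d ∈ S := by
    intro d hd
    induction hd using Submodule.span_induction with
    | mem d hd => obtain ⟨a, rfl⟩ := hd; exact toeplitzMinor_mem S hS a
    | zero => exact S.zero_mem
    | add d e _ _ hd he => exact S.add_mem hd he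
    | smul s d _ hd => exact S.mul_mem s.2 hd
  have hall : ∀ d ∈ N, g * d ∈ N := by
    induction hg using Algebra.adjoin_induction with
    | mem g hg =>
      rcases hg with ⟨i, rfl⟩ | ⟨i, rfl⟩
      · exact hx i
      · exact hy i
    | algebraMap r =>
      intro d hd
      exact N.smul_mem (algebraMap A S r) hd
    | add g h _ _ hg hh => intro d hd; rw [add_mul]; exact N.add_mem (hg d hd) (hh d hd)
    | mul g h _ _ hg hh => intro d hd; rw [mul_assoc]; exact hg _ (hh d hd)
  rw [mul_comm, ← toeplitzMinor_rectangle hf]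
  exact hNS _ (hall _ (Submodule.subset_span (Set.mem_range_self _)))

end Core

section GeneratingFunction

lemma mk_sum_sym_eq_prod {P : Type*} [CommRing P] {ι : Type*} [Fintype ι] [DecidableEq ι]
    (y : ι → P) :
    PowerSeries.mk (fun r => ∑ s : Sym ι r, (s.1.map y).prod) =
      ∏ j, PowerSeries.mk (fun k => y j ^ k) := by
  ext r
  rw [PowerSeries.coeff_mk, PowerSeries.coeff_prod]
  refine Finset.sum_bij (fun s _ => Multiset.toFinsupp s.1) ?_ ?_ ?_ ?_
  · intro s _
    rw [Finset.mem_finsuppAntidiag]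
    refine ⟨?_, Finset.subset_univ _⟩
    change ∑ i, Multiset.toFinsupp s.1 i = r
    simp only [Multiset.toFinsupp_apply]
    rw [Multiset.sum_count_eq_card (by simp)]
    exact s.2
  · intro s _ t _ h
    exact Subtype.ext (Multiset.toFinsupp.injective h)
  · intro l hl
    rw [Finset.mem_finsuppAntidiag] at hl
    refine ⟨⟨Finsupp.toMultiset l, ?_⟩, Finset.mem_univ _, by simp⟩
    rw [Finsupp.card_toMultiset, Finsupp.sum_fintype _ _ (by simp)]
    exact hl.1
  · intro s _
    simp only [PowerSeries.coeff_mk, Multiset.toFinsupp_apply]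
    rw [Finset.prod_multiset_map_count]
    refine Finset.prod_subset (Finset.subset_univ _) fun i _ hi => ?_
    rw [Multiset.mem_toFinset] at hi
    rw [Multiset.count_eq_zero_of_notMem hi, pow_zero]

lemma mk_sum_sym_mul_prod {P : Type*} [CommRing P] {ι : Type*} [Fintype ι] [DecidableEq ι]
    (y : ι → P) :
    PowerSeries.mk (fun r => ∑ s : Sym ι r, (s.1.map y).prod) *
      ∏ j, (1 - PowerSeries.C (y j) * PowerSeries.X) = 1 := by
  rw [mk_sum_sym_eq_prod, ← Finset.prod_mul_distrib]
  refine Finset.prod_eq_one fun j _ => ?_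
  ext k
  rw [mul_sub, mul_one, ← mul_assoc, map_sub]
  cases k with
  | zero => simp
  | succ k =>
    rw [PowerSeries.coeff_succ_mul_X, mul_comm, PowerSeries.coeff_C_mul]
    simp [PowerSeries.coeff_one, pow_succ, mul_comm]

lemma rename_esymm_eq {A ι κ : Type*} [CommRing A] [Fintype ι] (e : ι → κ) (k : ℕ) :
    rename e (esymm ι A k) =
      (Finset.univ.val.map fun i => (X (e i) : MvPolynomial κ A)).esymm k := by
  rw [← aeval_esymm_eq_multiset_esymm ι A k]
  simp [esymm]

variable (A : Type*) [CommRing A] (m n : ℕ)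

/-- The generating function of the polynomials `(-1) ^ r * c_r(x|y)`. -/
def cSeries : PowerSeries (MvPolynomial (Fin m ⊕ Fin n) A) :=
  PowerSeries.mk fun r => (-1) ^ r * cpoly A m n r

lemma cSeries_mul_prod :
    cSeries A m n * ∏ j, (1 - PowerSeries.C (X (Sum.inr j)) * PowerSeries.X) =
      ∏ i, (1 - PowerSeries.C (X (Sum.inl i)) * PowerSeries.X) := by
  have h : cSeries A m n = (∏ i, (1 - PowerSeries.C (X (Sum.inl i)) * PowerSeries.X)) *
      PowerSeries.mk (fun r => ∑ s : Sym (Fin n) r,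
        (s.1.map fun j => (X (Sum.inr j) : MvPolynomial (Fin m ⊕ Fin n) A)).prod) := by
    ext1 r
    rw [PowerSeries.coeff_mul, Finset.Nat.sum_antidiagonal_eq_sum_range_succ_mk, cSeries,
      PowerSeries.coeff_mk, cpoly, Finset.mul_sum]
    refine Finset.sum_subset_zero_on_sdiff (by intro k; simp; omega) ?_ ?_
    · intro k hk
      simp only [Finset.mem_sdiff, Finset.mem_range] at hk
      rw [coeff_prod_one_sub, esymm_map_eq_zero _ (by simp; omega), mul_zero, zero_mul]
    · intro k hk
      simp only [Finset.mem_range] at hk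
      rw [coeff_prod_one_sub, PowerSeries.coeff_mk, rename_esymm_eq, hsymm, map_sum]
      have hs : (-1 : MvPolynomial (Fin m ⊕ Fin n) A) ^ r * (-1) ^ (r - k) = (-1) ^ k := by
        obtain ⟨d, rfl⟩ : ∃ d, r = k + d := ⟨r - k, by omega⟩
        rw [add_tsub_cancel_left, pow_add, mul_assoc, ← mul_pow]
        simp
      rw [← mul_assoc, ← mul_assoc, hs]
      congr 1
      refine Finset.sum_congr rfl fun s _ => ?_
      rw [map_multiset_prod, Multiset.map_map]
      simp [Function.comp_def]
  rw [h, mul_assoc, mk_sum_sym_mul_prod, mul_one]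

end GeneratingFunction

section DoublySymmetric

variable {A : Type*} [CommRing A] {m n : ℕ}

lemma sumAlgEquiv_symm_C_eq_rename (c : MvPolynomial (Fin n) A) :
    (sumAlgEquiv A (Fin m) (Fin n)).symm (C c) = rename Sum.inr c := by
  have : ((sumAlgEquiv A (Fin m) (Fin n)).symm.toAlgHom.toRingHom.comp C) =
      (rename Sum.inr : MvPolynomial (Fin n) A →ₐ[A] MvPolynomial (Fin m ⊕ Fin n) A).toRingHom := by
    ext i
    · simp
    · simp
  exact congrArg (fun φ => φ c) this

lemma rename_sumAlgEquiv (σ : Fin m → Fin m) (f : MvPolynomial (Fin m ⊕ Fin n) A) :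
    rename σ (sumAlgEquiv A (Fin m) (Fin n) f) =
      sumAlgEquiv A (Fin m) (Fin n) (rename (Sum.map σ id) f) := by
  induction f using MvPolynomial.induction_on with
  | C a => simp
  | add p q hp hq => simp only [map_add, hp, hq]
  | mul_X p i hp => rcases i with i | i <;> simp [hp]

lemma map_sumAlgEquiv (τ : Fin n → Fin n) (f : MvPolynomial (Fin m ⊕ Fin n) A) :
    map (rename τ : MvPolynomial (Fin n) A →ₐ[A] MvPolynomial (Fin n) A).toRingHom
      (sumAlgEquiv A (Fin m) (Fin n) f) =
      sumAlgEquiv A (Fin m) (Fin n) (rename (Sum.map id τ) f) := by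
  induction f using MvPolynomial.induction_on with
  | C a => simp
  | add p q hp hq => simp only [map_add, hp, hq]
  | mul_X p i hp => rcases i with i | i <;> simp_all

lemma IsSymmetric.exists_aeval_esymm {R : Type*} [CommRing R] {k : ℕ} {f : MvPolynomial (Fin k) R}
    (hf : f.IsSymmetric) :
    ∃ q : MvPolynomial (Fin k) R, aeval (fun i : Fin k => esymm (Fin k) R (i + 1)) q = f := by
  obtain ⟨q, hq⟩ := (esymmAlgHom_fin_surjective R (le_refl k)) ⟨f, hf⟩
  exact ⟨q, by rw [← esymmAlgHom_apply, hq]⟩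

/-- A polynomial symmetric in each of two sets of variables is a polynomial in the elementary
symmetric polynomials of the two sets. -/
theorem mem_adjoin_esymm_of_symmetric {f : MvPolynomial (Fin m ⊕ Fin n) A}
    (h₁ : ∀ σ : Equiv.Perm (Fin m), rename (Sum.map σ id) f = f)
    (h₂ : ∀ τ : Equiv.Perm (Fin n), rename (Sum.map id τ) f = f) :
    f ∈ Algebra.adjoin A
      (Set.range (Finset.univ.val.map
          fun i => (X (Sum.inl i) : MvPolynomial (Fin m ⊕ Fin n) A)).esymm
      ∪ Set.range (Finset.univ.val.map
          fun j => (X (Sum.inr j) : MvPolynomial (Fin m ⊕ Fin n) A)).esymm) := by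
  set S := Algebra.adjoin A
      (Set.range (Finset.univ.val.map
          fun i => (X (Sum.inl i) : MvPolynomial (Fin m ⊕ Fin n) A)).esymm
      ∪ Set.range (Finset.univ.val.map
          fun j => (X (Sum.inr j) : MvPolynomial (Fin m ⊕ Fin n) A)).esymm) with hS
  set F := sumAlgEquiv A (Fin m) (Fin n) f with hF
  have hFsymm : F.IsSymmetric := fun σ => by rw [hF, rename_sumAlgEquiv, h₁]
  obtain ⟨q, hq⟩ := IsSymmetric.exists_aeval_esymm hFsymm
  have hcoeff : ∀ d, (coeff d q).IsSymmetric := by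
    intro d τ
    set φ := (rename τ : MvPolynomial (Fin n) A →ₐ[A] MvPolynomial (Fin n) A).toRingHom
    have hmap : map φ q = q := by
      apply esymmAlgHom_fin_injective (MvPolynomial (Fin n) A) (le_refl m)
      apply Subtype.ext
      rw [esymmAlgHom_apply, esymmAlgHom_apply, hq]
      have h3 : map φ F = F := by rw [hF, map_sumAlgEquiv, h₂]
      rw [← h3, ← hq]
      rw [aeval_def, aeval_def, eval₂_map, eval₂_comp_left]
      congr 1
      · refine RingHom.ext fun c => ?_
        simp
      · funext i
        simp [map_esymm]
    conv_rhs => rw [← hmap, coeff_map]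
    rfl
  have hinr : ∀ c : MvPolynomial (Fin n) A, c.IsSymmetric → rename Sum.inr c ∈ S := by
    intro c hc
    obtain ⟨p, rfl⟩ := IsSymmetric.exists_aeval_esymm hc
    rw [aeval_def, eval₂_eq', map_sum]
    refine S.sum_mem fun d _ => ?_
    rw [map_mul, map_prod]
    refine S.mul_mem ?_ (S.prod_mem fun i _ => ?_)
    · simpa using S.algebraMap_mem (coeff d p)
    · rw [map_pow, rename_esymm_eq]
      exact S.pow_mem (Algebra.subset_adjoin (Or.inr ⟨_, rfl⟩)) _
  have hf : f = (sumAlgEquiv A (Fin m) (Fin n)).symm F := by simp [hF]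
  rw [hf, ← hq, aeval_def, eval₂_eq', map_sum]
  refine S.sum_mem fun d _ => ?_
  rw [map_mul, map_prod]
  refine S.mul_mem ?_ (S.prod_mem fun i _ => ?_)
  · rw [algebraMap_eq, sumAlgEquiv_symm_C_eq_rename]
    exact hinr _ (hcoeff d)
  · rw [map_pow]
    refine S.pow_mem (Algebra.subset_adjoin (Or.inl ⟨i + 1, ?_⟩)) _
    rw [← rename_esymm_eq Sum.inl]
    simp [esymm, map_sum, map_prod]

end DoublySymmetric

section Divisibility

variable {A : Type*} [CommRing A]

lemma sub_dvd_sub_aeval_update {σ : Type*} [DecidableEq σ] (a b : σ) (f : MvPolynomial σ A) :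
    (X a - X b) ∣ f - aeval (Function.update X a (X b)) f := by
  induction f using MvPolynomial.induction_on with
  | C r => simp
  | add p q hp hq =>
    rw [map_add, add_sub_add_comm]
    exact dvd_add hp hq
  | mul_X p i hp =>
    rw [map_mul, aeval_X]
    have : p * X i - aeval (Function.update X a (X b)) p * Function.update X a (X b) i =
        (p - aeval (Function.update X a (X b)) p) * X i +
          aeval (Function.update X a (X b)) p * (X i - Function.update X a (X b) i) := by ring
    rw [this]
    refine dvd_add (Dvd.dvd.mul_right hp _) (Dvd.dvd.mul_left ?_ _)
    by_cases h : i = a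
    · subst h; simp
    · simp [h]

lemma sub_dvd_iff_aeval_update_eq_zero {σ : Type*} [DecidableEq σ] (a b : σ)
    (f : MvPolynomial σ A) :
    (X a - X b) ∣ f ↔
      aeval (Function.update X a (X b) : σ → MvPolynomial σ A) f = 0 := by
  constructor
  · rintro ⟨g, rfl⟩
    rw [map_mul, map_sub, aeval_X, aeval_X, Function.update_self]
    by_cases h : b = a
    · subst h; simp
    · simp [h]
  · intro h
    have := sub_dvd_sub_aeval_update a b f
    rwa [h, sub_zero] at this

lemma isLeftRegular_X_sub_X {σ : Type*} {a b : σ} (hab : a ≠ b) :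
    IsLeftRegular (X a - X b : MvPolynomial σ A) := by
  classical
  rw [isLeftRegular_iff_right_eq_zero_of_mul]
  intro g hg
  set φ : MvPolynomial σ A →ₐ[A] MvPolynomial σ A := aeval (Function.update X a (X a + X b))
  set ψ : MvPolynomial σ A →ₐ[A] MvPolynomial σ A := aeval (Function.update X a (X a - X b))
  have hψφ : ψ.comp φ = AlgHom.id A _ := by
    apply MvPolynomial.algHom_ext
    intro i
    by_cases h : i = a
    · subst h; simp [φ, ψ, hab.symm]
    · simp [φ, ψ, h]
  have h1 : X a * φ g = 0 := by
    have := congrArg φ hg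
    simpa [φ, hab.symm] using this
  have h2 : φ g = 0 := by
    ext d
    have := congrArg (coeff (d + Finsupp.single a 1)) h1
    rwa [mul_comm, coeff_mul_X, coeff_zero] at this
  have h3 := congrArg ψ h2
  rw [← AlgHom.comp_apply, hψφ] at h3
  simpa using h3

lemma prod_sub_dvd {ι κ : Type*} {f : MvPolynomial (ι ⊕ κ) A} (s : Finset (ι × κ))
    (h : ∀ p ∈ s, (X (Sum.inr p.2) - X (Sum.inl p.1) : MvPolynomial (ι ⊕ κ) A) ∣ f) :
    (∏ p ∈ s, (X (Sum.inr p.2) - X (Sum.inl p.1) : MvPolynomial (ι ⊕ κ) A)) ∣ f := by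
  classical
  induction s using Finset.induction_on with
  | empty => simp
  | insert p s hp ih =>
    obtain ⟨g, hg⟩ := ih fun q hq => h q (Finset.mem_insert_of_mem hq)
    have h1 := (sub_dvd_iff_aeval_update_eq_zero _ _ _).1 (h p (Finset.mem_insert_self _ _))
    rw [hg, map_mul, map_prod] at h1
    have hreg : IsLeftRegular (∏ q ∈ s, aeval (Function.update X (Sum.inr p.2) (X (Sum.inl p.1)) :
        ι ⊕ κ → MvPolynomial (ι ⊕ κ) A)
        (X (Sum.inr q.2) - X (Sum.inl q.1) : MvPolynomial (ι ⊕ κ) A)) := by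
      refine IsLeftRegular.prod fun q hq => ?_
      have hqp : q ≠ p := fun h => hp (h ▸ hq)
      by_cases h2 : q.2 = p.2
      · have h3 : p.1 ≠ q.1 := fun h3 => hqp (Prod.ext h3.symm h2)
        simpa [h2] using isLeftRegular_X_sub_X (A := A) (Sum.inl_injective.ne h3)
      · simpa [h2] using isLeftRegular_X_sub_X (A := A) (a := (Sum.inr q.2 : ι ⊕ κ))
          (b := Sum.inl q.1) (by simp)
    obtain ⟨k, rfl⟩ := (sub_dvd_iff_aeval_update_eq_zero _ _ _).2
      (isLeftRegular_iff_right_eq_zero_of_mul.1 hreg _ h1)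
    rw [Finset.prod_insert hp]
    exact ⟨k, by rw [hg]; ring⟩

end Divisibility

section Supersymmetric

universe u

variable {A : Type u} [CommRing A] {m n : ℕ}

/-- Symmetry in both sets of variables together with the cancellation property for arbitrary
evaluations: if one `x` variable and one `y` variable take the same value `t`, then the value of
`f` does not depend on `t`. -/
structure HasCancellation (f : MvPolynomial (Fin m ⊕ Fin n) A) : Prop where
  rename_inl (σ : Equiv.Perm (Fin m)) : rename (Sum.map σ id) f = f
  rename_inr (τ : Equiv.Perm (Fin n)) : rename (Sum.map id τ) f = f
  aeval_update (B : Type u) [CommRing B] [Algebra A B] (a : Fin m → B) (b : Fin n → B)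
    (i : Fin m) (j : Fin n) (t t' : B) :
    aeval (Sum.elim (Function.update a i t) (Function.update b j t)) f =
      aeval (Sum.elim (Function.update a i t') (Function.update b j t')) f

lemma aeval_elim_comp {f : MvPolynomial (Fin m ⊕ Fin n) A} {B : Type*} [CommRing B] [Algebra A B]
    (h₁ : ∀ σ : Equiv.Perm (Fin m), rename (Sum.map σ id) f = f)
    (h₂ : ∀ τ : Equiv.Perm (Fin n), rename (Sum.map id τ) f = f)
    (a : Fin m → B) (b : Fin n → B) (σ : Equiv.Perm (Fin m)) (τ : Equiv.Perm (Fin n)) :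
    aeval (Sum.elim (a ∘ σ) (b ∘ τ)) f = aeval (Sum.elim a b) f := by
  conv_rhs => rw [← h₁ σ, aeval_rename, Sum.elim_comp_map, Function.comp_id, ← h₂ τ, aeval_rename,
    Sum.elim_comp_map, Function.comp_id]

lemma HasCancellation.of_psiSub (hm : 1 ≤ m) (hn : 1 ≤ n) {f : MvPolynomial (Fin m ⊕ Fin n) A}
    (h₁ : ∀ σ : Equiv.Perm (Fin m), rename (Sum.map σ id) f = f)
    (h₂ : ∀ τ : Equiv.Perm (Fin n), rename (Sum.map id τ) f = f)
    {c : MvPolynomial (Fin m ⊕ Fin n) A} (hc : psiSub A m n f = Polynomial.C c) :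
    HasCancellation f := by
  refine ⟨h₁, h₂, fun B _ _ a b i j t t' => ?_⟩
  set i₀ : Fin m := ⟨m - 1, by omega⟩
  set j₀ : Fin n := ⟨n - 1, by omega⟩
  have key : ∀ (a : Fin m → B) (b : Fin n → B) (t : B),
      aeval (Sum.elim (Function.update a i₀ t) (Function.update b j₀ t)) f =
        aeval (Sum.elim a b) c := by
    intro a b t
    set φ := Polynomial.aevalTower (aeval (R := A) (Sum.elim a b)) t
    have h : aeval (Sum.elim (Function.update a i₀ t) (Function.update b j₀ t)) =
        φ.comp (psiSub A m n) := by
      refine MvPolynomial.algHom_ext fun k => ?_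
      rcases k with k | k
      · by_cases hk : (k : ℕ) = m - 1
        · have : k = i₀ := Fin.ext hk
          simp [-Sum.elim_update_left, -Sum.elim_update_right, psiSub, φ, this, i₀]
        · have : k ≠ i₀ := fun h => hk (congrArg Fin.val h)
          simp [-Sum.elim_update_left, -Sum.elim_update_right, psiSub, φ, this, hk]
      · by_cases hk : (k : ℕ) = n - 1
        · have : k = j₀ := Fin.ext hk
          simp [-Sum.elim_update_left, -Sum.elim_update_right, psiSub, φ, this, j₀]
        · have : k ≠ j₀ := fun h => hk (congrArg Fin.val h)
          simp [-Sum.elim_update_left, -Sum.elim_update_right, psiSub, φ, this, hk]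
    rw [h, AlgHom.comp_apply, hc]
    simp [φ]
  have hmove : ∀ t : B, aeval (Sum.elim (Function.update a i t) (Function.update b j t)) f =
      aeval (Sum.elim (a ∘ Equiv.swap i i₀) (b ∘ Equiv.swap j j₀)) c := by
    intro t
    rw [← aeval_elim_comp h₁ h₂ _ _ (Equiv.swap i i₀) (Equiv.swap j j₀),
      Function.update_comp_equiv, Function.update_comp_equiv, Equiv.symm_swap, Equiv.symm_swap,
      Equiv.swap_apply_left, Equiv.swap_apply_left, key]
  rw [hmove, hmove]

lemma map_cSeries_mul_prod {B : Type*} [CommRing B] [Algebra A B] (v : Fin m ⊕ Fin n → B) :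
    PowerSeries.map (aeval v : MvPolynomial (Fin m ⊕ Fin n) A →ₐ[A] B).toRingHom (cSeries A m n) *
      ∏ j, (1 - PowerSeries.C (v (Sum.inr j)) * PowerSeries.X) =
      ∏ i, (1 - PowerSeries.C (v (Sum.inl i)) * PowerSeries.X) := by
  have := congrArg (PowerSeries.map
    (aeval v : MvPolynomial (Fin m ⊕ Fin n) A →ₐ[A] B).toRingHom) (cSeries_mul_prod A m n)
  simpa [map_prod] using this

/-- The value of `c_r(x|y)` only depends on the quotient of the two products
`∏ (1 - x_i T)` and `∏ (1 - y_j T)`. -/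
lemma aeval_cpoly_congr {B : Type*} [CommRing B] [Algebra A B] {m' n' : ℕ}
    (v : Fin m ⊕ Fin n → B) (v' : Fin m' ⊕ Fin n' → B)
    (h : (∏ i, (1 - PowerSeries.C (v (Sum.inl i)) * PowerSeries.X)) *
        ∏ j, (1 - PowerSeries.C (v' (Sum.inr j)) * PowerSeries.X) =
      (∏ i, (1 - PowerSeries.C (v' (Sum.inl i)) * PowerSeries.X)) *
        ∏ j, (1 - PowerSeries.C (v (Sum.inr j)) * PowerSeries.X)) (r : ℕ) :
    aeval v (cpoly A m n r) = aeval v' (cpoly A m' n' r) := by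
  have hY := IsUnit.of_mul_eq_one_right _ (mk_sum_sym_mul_prod fun j => v (Sum.inr j))
  have hY' := IsUnit.of_mul_eq_one_right _ (mk_sum_sym_mul_prod fun j => v' (Sum.inr j))
  rw [← map_cSeries_mul_prod (A := A) v, ← map_cSeries_mul_prod (A := A) v', mul_assoc, mul_assoc,
    mul_comm (∏ j, (1 - PowerSeries.C (v' (Sum.inr j)) * PowerSeries.X))] at h
  have hr := congrArg (PowerSeries.coeff r) ((hY.mul hY').mul_right_cancel h)
  simpa [cSeries, ((isUnit_one (M := B)).neg.pow r).mul_right_inj] using hr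

lemma aeval_congr_of_mem_adjoin {B : Type*} [CommRing B] [Algebra A B]
    {v v' : Fin m ⊕ Fin n → B}
    (h : (∏ i, (1 - PowerSeries.C (v (Sum.inl i)) * PowerSeries.X)) *
        ∏ j, (1 - PowerSeries.C (v' (Sum.inr j)) * PowerSeries.X) =
      (∏ i, (1 - PowerSeries.C (v' (Sum.inl i)) * PowerSeries.X)) *
        ∏ j, (1 - PowerSeries.C (v (Sum.inr j)) * PowerSeries.X))
    {f : MvPolynomial (Fin m ⊕ Fin n) A}
    (hf : f ∈ Algebra.adjoin A {f | ∃ r : ℕ, f = cpoly A m n r}) :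
    aeval v f = aeval v' f := by
  have hle : Algebra.adjoin A {f | ∃ r : ℕ, f = cpoly A m n r} ≤
      AlgHom.equalizer (aeval v) (aeval v') := by
    refine Algebra.adjoin_le ?_
    rintro _ ⟨r, rfl⟩
    exact aeval_cpoly_congr v v' h r
  exact hle hf

lemma prod_one_sub_update {B : Type*} [CommRing B] {ι : Type*} [Fintype ι] [DecidableEq ι]
    (a : ι → B) (i : ι) (t : B) :
    ∏ k, (1 - PowerSeries.C (Function.update a i t k) * PowerSeries.X) =
      (1 - PowerSeries.C t * PowerSeries.X) *
        ∏ k ∈ Finset.univ.erase i, (1 - PowerSeries.C (a k) * PowerSeries.X) := by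
  rw [← Finset.mul_prod_erase _ _ (Finset.mem_univ i), Function.update_self]
  congr 1
  refine Finset.prod_congr rfl fun k hk => ?_
  rw [Function.update_of_ne (Finset.ne_of_mem_erase hk)]

lemma HasCancellation.of_mem_adjoin {f : MvPolynomial (Fin m ⊕ Fin n) A}
    (hf : f ∈ Algebra.adjoin A {f | ∃ r : ℕ, f = cpoly A m n r}) : HasCancellation f := by
  refine ⟨fun σ => ?_, fun τ => ?_, fun B _ _ a b i j t t' => ?_⟩
  · conv_rhs => rw [← aeval_X_left_apply f]
    rw [← aeval_X_left_apply (rename _ f), aeval_rename]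
    refine aeval_congr_of_mem_adjoin ?_ hf
    simp only [Function.comp_apply, Sum.map_inl, Sum.map_inr, id]
    rw [Equiv.prod_comp σ fun i => (1 - PowerSeries.C
      (X (Sum.inl i) : MvPolynomial (Fin m ⊕ Fin n) A) * PowerSeries.X)]
  · conv_rhs => rw [← aeval_X_left_apply f]
    rw [← aeval_X_left_apply (rename _ f), aeval_rename]
    refine aeval_congr_of_mem_adjoin ?_ hf
    simp only [Function.comp_apply, Sum.map_inl, Sum.map_inr, id]
    rw [Equiv.prod_comp τ fun i => (1 - PowerSeries.C
      (X (Sum.inr i) : MvPolynomial (Fin m ⊕ Fin n) A) * PowerSeries.X)]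
  · refine aeval_congr_of_mem_adjoin ?_ hf
    simp only [Sum.elim_inl, Sum.elim_inr, prod_one_sub_update]
    ring

lemma HasCancellation.exists_psiSub_eq_C (hm : 1 ≤ m) (hn : 1 ≤ n)
    {f : MvPolynomial (Fin m ⊕ Fin n) A} (hf : HasCancellation f) :
    ∃ c, psiSub A m n f = Polynomial.C c := by
  set a : Fin m → MvPolynomial (Fin m ⊕ Fin n) A := fun i => X (Sum.inl i)
  set b : Fin n → MvPolynomial (Fin m ⊕ Fin n) A := fun j => X (Sum.inr j)
  set i₀ : Fin m := ⟨m - 1, by omega⟩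
  set j₀ : Fin n := ⟨n - 1, by omega⟩
  refine ⟨aeval (Sum.elim (Function.update a i₀ 0) (Function.update b j₀ 0)) f, ?_⟩
  have h := hf.aeval_update (Polynomial (MvPolynomial (Fin m ⊕ Fin n) A))
    (Polynomial.C ∘ a) (Polynomial.C ∘ b) i₀ j₀ Polynomial.X 0
  have h₁ : psiSub A m n = aeval (Sum.elim (Function.update (Polynomial.C ∘ a) i₀ Polynomial.X)
      (Function.update (Polynomial.C ∘ b) j₀ Polynomial.X)) := by
    refine MvPolynomial.algHom_ext fun k => ?_
    rcases k with k | k <;>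
      simp [-Sum.elim_update_left, -Sum.elim_update_right, psiSub,
        Function.update_apply, i₀, j₀, Fin.ext_iff, a, b]
  have h₂ : aeval (Sum.elim (Function.update (Polynomial.C ∘ a) i₀ 0)
      (Function.update (Polynomial.C ∘ b) j₀ 0)) =
      Polynomial.CAlgHom.comp
      (aeval (Sum.elim (Function.update a i₀ 0) (Function.update b j₀ 0)) :
        MvPolynomial (Fin m ⊕ Fin n) A →ₐ[A] MvPolynomial (Fin m ⊕ Fin n) A) := by
    refine MvPolynomial.algHom_ext fun k => ?_
    rcases k with k | k
    · by_cases hk : k = i₀ <;> simp [-Sum.elim_update_left, -Sum.elim_update_right, hk]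
    · by_cases hk : k = j₀ <;> simp [-Sum.elim_update_left, -Sum.elim_update_right, hk]
  rw [h₁, h, h₂]
  rfl

/-- Setting one variable of each kind to zero. -/
def killFirst (A : Type*) [CommRing A] (m n : ℕ) :
    MvPolynomial (Fin (m + 1) ⊕ Fin (n + 1)) A →ₐ[A] MvPolynomial (Fin m ⊕ Fin n) A :=
  aeval (Sum.elim (Fin.cons 0 fun i => X (Sum.inl i)) (Fin.cons 0 fun j => X (Sum.inr j)))

lemma aeval_killFirst {B : Type*} [CommRing B] [Algebra A B] (a : Fin m → B) (b : Fin n → B)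
    (f : MvPolynomial (Fin (m + 1) ⊕ Fin (n + 1)) A) :
    aeval (Sum.elim a b) (killFirst A m n f) =
      aeval (Sum.elim (Fin.cons 0 a : Fin (m + 1) → B) (Fin.cons 0 b : Fin (n + 1) → B)) f := by
  rw [killFirst, ← AlgHom.comp_apply]
  congr 1
  refine MvPolynomial.algHom_ext fun k => ?_
  rcases k with k | k <;> cases k using Fin.cases <;> simp

lemma aeval_of_zero_zero {B : Type*} [CommRing B] [Algebra A B] {a : Fin (m + 1) → B}
    {b : Fin (n + 1) → B} (ha : a 0 = 0) (hb : b 0 = 0)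
    (f : MvPolynomial (Fin (m + 1) ⊕ Fin (n + 1)) A) :
    aeval (Sum.elim a b) f =
      aeval (Sum.elim (Fin.tail a) (Fin.tail b)) (killFirst A m n f) := by
  rw [aeval_killFirst]
  nth_rewrite 1 [← Fin.cons_self_tail a, ← Fin.cons_self_tail b]
  rw [ha, hb]

lemma killFirst_cpoly (r : ℕ) : killFirst A m n (cpoly A (m + 1) (n + 1) r) = cpoly A m n r := by
  conv_rhs => rw [← aeval_X_left_apply (cpoly A m n r)]
  refine aeval_cpoly_congr _ _ ?_ r
  simp [Fin.prod_univ_succ]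

lemma exists_mem_adjoin_killFirst_eq {f : MvPolynomial (Fin m ⊕ Fin n) A}
    (hf : f ∈ Algebra.adjoin A {f | ∃ r : ℕ, f = cpoly A m n r}) :
    ∃ g ∈ Algebra.adjoin A {f | ∃ r : ℕ, f = cpoly A (m + 1) (n + 1) r},
      killFirst A m n g = f := by
  have hle : Algebra.adjoin A {f | ∃ r : ℕ, f = cpoly A m n r} ≤
      (Algebra.adjoin A {f | ∃ r : ℕ, f = cpoly A (m + 1) (n + 1) r}).map (killFirst A m n) := by
    refine Algebra.adjoin_le ?_
    rintro _ ⟨r, rfl⟩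
    exact ⟨_, Algebra.subset_adjoin ⟨r, rfl⟩, killFirst_cpoly r⟩
  exact hle hf

lemma cons_comp_perm {B : Type*} (z : B) (a : Fin m → B) (σ : Equiv.Perm (Fin m)) :
    (Fin.cons z (a ∘ σ) : Fin (m + 1) → B) =
      (Fin.cons z a : Fin (m + 1) → B) ∘ Equiv.Perm.decomposeFin.symm (0, σ) := by
  funext k
  cases k using Fin.cases <;> simp [Equiv.Perm.decomposeFin_symm_apply_succ]

lemma HasCancellation.killFirst_apply {f : MvPolynomial (Fin (m + 1) ⊕ Fin (n + 1)) A}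
    (hf : HasCancellation f) : HasCancellation (killFirst A m n f) := by
  have key : ∀ (σ : Equiv.Perm (Fin m)) (τ : Equiv.Perm (Fin n)),
      rename (Sum.map σ τ) (killFirst A m n f) = killFirst A m n f := by
    intro σ τ
    conv_rhs => rw [← aeval_X_left_apply (killFirst A m n f),
      ← Sum.elim_comp_inl_inr (X : Fin m ⊕ Fin n → MvPolynomial (Fin m ⊕ Fin n) A),
      aeval_killFirst, ← aeval_elim_comp hf.rename_inl hf.rename_inr _ _
        (Equiv.Perm.decomposeFin.symm (0, σ)) (Equiv.Perm.decomposeFin.symm (0, τ)),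
      ← cons_comp_perm, ← cons_comp_perm, ← aeval_killFirst, ← Sum.elim_comp_map,
      Sum.elim_comp_inl_inr, ← aeval_rename, aeval_X_left_apply]
  refine ⟨fun σ => key σ 1, fun τ => key 1 τ, fun B _ _ a b i j t t' => ?_⟩
  rw [aeval_killFirst, aeval_killFirst, Fin.cons_update, Fin.cons_update, Fin.cons_update,
    Fin.cons_update]
  exact hf.aeval_update B _ _ i.succ j.succ t t'

lemma HasCancellation.sub {f g : MvPolynomial (Fin m ⊕ Fin n) A} (hf : HasCancellation f)
    (hg : HasCancellation g) : HasCancellation (f - g) :=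
  ⟨fun σ => by rw [map_sub, hf.rename_inl, hg.rename_inl],
    fun τ => by rw [map_sub, hf.rename_inr, hg.rename_inr],
    fun B _ _ a b i j t t' => by
      rw [map_sub, map_sub, hf.aeval_update B a b i j t t', hg.aeval_update B a b i j t t']⟩

lemma HasCancellation.prod_dvd_of_killFirst_eq_zero {f : MvPolynomial (Fin (m + 1) ⊕ Fin (n + 1)) A}
    (hf : HasCancellation f) (h0 : killFirst A m n f = 0) :
    (∏ p : Fin (m + 1) × Fin (n + 1),
      (X (Sum.inr p.2) - X (Sum.inl p.1) : MvPolynomial (Fin (m + 1) ⊕ Fin (n + 1)) A)) ∣ f := by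
  refine prod_sub_dvd _ fun p _ => (sub_dvd_iff_aeval_update_eq_zero _ _ _).2 ?_
  set a : Fin (m + 1) → MvPolynomial (Fin (m + 1) ⊕ Fin (n + 1)) A := fun i => X (Sum.inl i)
  set b : Fin (n + 1) → MvPolynomial (Fin (m + 1) ⊕ Fin (n + 1)) A := fun j => X (Sum.inr j)
  have hX : Function.update (X : _ → MvPolynomial (Fin (m + 1) ⊕ Fin (n + 1)) A)
      (Sum.inr p.2) (X (Sum.inl p.1)) =
      Sum.elim (Function.update a p.1 (a p.1)) (Function.update b p.2 (a p.1)) := by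
    rw [Function.update_eq_self, Sum.elim_update_right]
    congr 1
    exact (Sum.elim_comp_inl_inr _).symm
  rw [hX, hf.aeval_update _ a b p.1 p.2 _ 0, ← aeval_elim_comp hf.rename_inl hf.rename_inr _ _
    (Equiv.swap p.1 0) (Equiv.swap p.2 0), aeval_of_zero_zero (by simp) (by simp), h0, map_zero]

lemma rename_prod_sub {ι κ : Type*} [Fintype ι] [Fintype κ] (σ : Equiv.Perm ι)
    (τ : Equiv.Perm κ) :
    rename (Sum.map σ τ) (∏ p : ι × κ,
      (X (Sum.inr p.2) - X (Sum.inl p.1) : MvPolynomial (ι ⊕ κ) A)) =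
      ∏ p : ι × κ, (X (Sum.inr p.2) - X (Sum.inl p.1)) := by
  rw [map_prod]
  conv_rhs => rw [← (σ.prodCongr τ).prod_comp]
  simp

lemma isLeftRegular_prod_sub {ι κ : Type*} [Fintype ι] [Fintype κ] :
    IsLeftRegular (∏ p : ι × κ,
      (X (Sum.inr p.2) - X (Sum.inl p.1) : MvPolynomial (ι ⊕ κ) A)) :=
  IsLeftRegular.prod fun _ _ => isLeftRegular_X_sub_X (by simp)

/-- The doubly symmetric multiples of `∏ (y_j - x_i)` are polynomials in the `c_r(x|y)`. -/
lemma prod_sub_mul_mem_adjoin_cpoly {g : MvPolynomial (Fin m ⊕ Fin n) A}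
    (h₁ : ∀ σ : Equiv.Perm (Fin m), rename (Sum.map σ id) g = g)
    (h₂ : ∀ τ : Equiv.Perm (Fin n), rename (Sum.map id τ) g = g) :
    (∏ p : Fin m × Fin n, (X (Sum.inr p.2) - X (Sum.inl p.1))) * g ∈
      Algebra.adjoin A {f | ∃ r : ℕ, f = cpoly A m n r} := by
  rw [Fintype.prod_prod_type]
  refine prod_sub_mul_mem _ _ _ (cSeries A m n) (cSeries_mul_prod A m n) (fun r => ?_)
    (mem_adjoin_esymm_of_symmetric h₁ h₂)
  rw [cSeries, PowerSeries.coeff_mk]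
  exact Subalgebra.mul_mem _ (Subalgebra.pow_mem _ (Subalgebra.neg_mem _ (Subalgebra.one_mem _)) _)
    (Algebra.subset_adjoin ⟨r, rfl⟩)

theorem HasCancellation.mem_adjoin {f : MvPolynomial (Fin m ⊕ Fin n) A} (hf : HasCancellation f) :
    f ∈ Algebra.adjoin A {f | ∃ r : ℕ, f = cpoly A m n r} := by
  induction m generalizing n with
  | zero => simpa using prod_sub_mul_mem_adjoin_cpoly hf.rename_inl hf.rename_inr
  | succ m ih =>
    cases n with
    | zero => simpa using prod_sub_mul_mem_adjoin_cpoly hf.rename_inl hf.rename_inr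
    | succ n =>
      obtain ⟨g, hg, hgf⟩ := exists_mem_adjoin_killFirst_eq (ih hf.killFirst_apply)
      have hF := hf.sub (.of_mem_adjoin hg)
      obtain ⟨q, hq⟩ := hF.prod_dvd_of_killFirst_eq_zero (by rw [map_sub, hgf, sub_self])
      have hfg : f - g ∈ Algebra.adjoin A {f | ∃ r : ℕ, f = cpoly A (m + 1) (n + 1) r} := by
        rw [hq]
        refine prod_sub_mul_mem_adjoin_cpoly (fun σ => isLeftRegular_prod_sub ?_)
          fun τ => isLeftRegular_prod_sub ?_
        · have := hF.rename_inl σ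
          rwa [hq, map_mul, ← Equiv.Perm.coe_one, rename_prod_sub] at this
        · have := hF.rename_inr τ
          rwa [hq, map_mul, ← Equiv.Perm.coe_one, rename_prod_sub] at this
      simpa using Subalgebra.add_mem _ hfg hg

end Supersymmetric
/-- **Proposition 4.1 (Stembridge's theorem over any commutative ring).**
Over an arbitrary commutative ring `A`, the algebra of polynomials symmetric in `x_1,…,x_m` and
`y_1,…,y_n` separately such that `f|_{x_m = y_n = T}` does not depend on `T` is generated by
the polynomials `c_r(x|y)`, `r ≥ 0`. -/
theorem stembridge_any_ring (A : Type*) [CommRing A] (m n : ℕ) (hm : 1 ≤ m) (hn : 1 ≤ n) :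
    {f : MvPolynomial (Fin m ⊕ Fin n) A |
        (∀ σ : Equiv.Perm (Fin m), MvPolynomial.rename (Sum.map σ id) f = f) ∧
        (∀ τ : Equiv.Perm (Fin n), MvPolynomial.rename (Sum.map id τ) f = f) ∧
        (∃ c, psiSub A m n f = Polynomial.C c)} =
      (Algebra.adjoin A {f | ∃ r : ℕ, f = cpoly A m n r} :
        Subalgebra A (MvPolynomial (Fin m ⊕ Fin n) A)) := by
  ext f
  constructor
  · rintro ⟨h₁, h₂, c, hc⟩
    exact (HasCancellation.of_psiSub hm hn h₁ h₂ hc).mem_adjoin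
  · intro hf
    have h := HasCancellation.of_mem_adjoin hf
    exact ⟨h.rename_inl, h.rename_inr, h.exists_psiSub_eq_C hm hn⟩

end
end
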